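/- arXiv:1604.04521 — 3 statements merged into one kernel-verified Lean document; each statement's English description precedes it below -/
import Mathlib

section
/- The operator A is weakly continuous on K_{g,h}(Ω,Ω'): if {u_j} is a sequence in K_{g,h}(Ω,Ω') and u ∈ K_{g,h}(Ω,Ω') with ‖u_j − u‖_{W^{s,p}(Ω')} → 0 as j → ∞, then for every v ∈ W^{s,p}(Ω') one has A u_j(v) → A u(v) as j → ∞. -/
open MeasureTheory Metric Filter
open scoped ENNReal Topology

noncomputable section

/-- `ℝ^n`. -/
abbrev Euc (n : ℕ) := EuclideanSpace ℝ (Fin n)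

/-- `L(a,b) = |a-b|^{p-2}(a-b)` (real powers; the convention `L(a,a)=0` holds automatically). -/
noncomputable def Lf (p a b : ℝ) : ℝ := |a - b| ^ (p - 2) * (a - b)

/-- A symmetric measurable kernel of order `(s,p)` with ellipticity constant `Λ`. -/
def IsKernel (n : ℕ) (s p Λ : ℝ) (K : Euc n → Euc n → ℝ) : Prop :=
  Measurable (Function.uncurry K) ∧
  (∀ x y, K x y = K y x) ∧ (∀ x y, 0 ≤ K x y) ∧
  (∀ᵐ z : Euc n × Euc n, Λ⁻¹ ≤ K z.1 z.2 * ‖z.1 - z.2‖ ^ ((n : ℝ) + s * p) ∧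
    K z.1 z.2 * ‖z.1 - z.2‖ ^ ((n : ℝ) + s * p) ≤ Λ)

/-- Membership in the fractional Sobolev space `W^{s,p}(D)` (finiteness of the norm). -/
def MemW (n : ℕ) (s p : ℝ) (D : Set (Euc n)) (v : Euc n → ℝ) : Prop :=
  AEMeasurable v (volume.restrict D) ∧
  IntegrableOn (fun x => |v x| ^ p) D volume ∧
  Integrable (fun q : Euc n × Euc n => |v q.1 - v q.2| ^ p / ‖q.1 - q.2‖ ^ ((n : ℝ) + s * p))
    ((volume.restrict D).prod (volume.restrict D))

/-- The `W^{s,p}(D)` norm. -/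
noncomputable def sobNorm (n : ℕ) (s p : ℝ) (D : Set (Euc n)) (v : Euc n → ℝ) : ℝ :=
  (∫ x in D, |v x| ^ p) ^ (1/p) +
  (∫ x in D, ∫ y in D, |v x - v y| ^ p / ‖x - y‖ ^ ((n : ℝ) + s * p)) ^ (1/p)

/-- The nonlocal tail `Tail(f; z, r)`. -/
noncomputable def tailF (n : ℕ) (s p : ℝ) (f : Euc n → ℝ) (z : Euc n) (r : ℝ) : ℝ :=
  (r ^ (s * p) * ∫ x in (ball z r)ᶜ, |f x| ^ (p - 1) * ‖x - z‖ ^ (-((n : ℝ) + s * p))) ^ (1/(p-1))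

/-- Membership in the tail space `L^{p-1}_{sp}(ℝ^n)`. -/
def MemTail (n : ℕ) (s p : ℝ) (f : Euc n → ℝ) : Prop :=
  AEMeasurable f volume ∧
  (∀ z : Euc n, ∀ r : ℝ, 0 < r → IntegrableOn (fun x => |f x| ^ (p - 1)) (ball z r) volume) ∧
  (∀ z : Euc n, ∀ r : ℝ, 0 < r →
    IntegrableOn (fun x => |f x| ^ (p - 1) * ‖x - z‖ ^ (-((n : ℝ) + s * p))) (ball z r)ᶜ volume)

/-- The admissible class `K_{g,h}(Ω,Ω')`. -/
def obstacleSet (n : ℕ) (s p : ℝ) (Ω Ω' : Set (Euc n)) (g : Euc n → ℝ) (h : Euc n → EReal) :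
    Set (Euc n → ℝ) :=
  {u | MemW n s p Ω' u ∧ (∀ᵐ x ∂(volume : Measure (Euc n)), x ∈ Ω → h x ≤ (u x : EReal)) ∧
    (∀ᵐ x ∂(volume : Measure (Euc n)), x ∉ Ω → u x = g x)}

/-- The functional `A u (v)`. -/
noncomputable def Aop (n : ℕ) (p : ℝ) (Ω Ω' : Set (Euc n)) (g : Euc n → ℝ)
    (K : Euc n → Euc n → ℝ) (u v : Euc n → ℝ) : ℝ :=
  (∫ x in Ω', ∫ y in Ω', Lf p (u x) (u y) * (v x - v y) * K x y) +
  2 * ∫ y in Ω'ᶜ, ∫ x in Ω, Lf p (u x) (g y) * v x * K x y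

/-- `u` solves the obstacle problem in `K_{g,h}(Ω,Ω')`. -/
def SolvesObstacle (n : ℕ) (s p : ℝ) (Ω Ω' : Set (Euc n)) (g : Euc n → ℝ) (h : Euc n → EReal)
    (K : Euc n → Euc n → ℝ) (u : Euc n → ℝ) : Prop :=
  u ∈ obstacleSet n s p Ω Ω' g h ∧
  ∀ v ∈ obstacleSet n s p Ω Ω' g h, 0 ≤ Aop n p Ω Ω' g K u (fun x => v x - u x)

/-- The essential oscillation of `f` on `A` (in `EReal`). -/
noncomputable def essOsc (n : ℕ) (A : Set (Euc n)) (f : Euc n → ℝ) : EReal :=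
  essSup (fun x => (f x : EReal)) (volume.restrict A) -
    essInf (fun x => (f x : EReal)) (volume.restrict A)

end

/-- The power nonlinearity. -/
noncomputable def phiP (p t : ℝ) : ℝ := |t| ^ (p - 2) * t

lemma abs_phiP {p : ℝ} (hp : 1 < p) (t : ℝ) : |phiP p t| = |t| ^ (p - 1) := by
  unfold phiP
  by_cases h : t = 0
  · subst h
    simp [Real.zero_rpow (show p - 1 ≠ 0 by linarith)]
  · have ht : 0 < |t| := abs_pos.mpr h
    rw [abs_mul, abs_of_nonneg (Real.rpow_nonneg ht.le _), show p - 1 = (p - 2) + 1 by ring,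
      Real.rpow_add ht, Real.rpow_one]

lemma phiP_mul (p a b : ℝ) : phiP p (a * b) = phiP p a * phiP p b := by
  unfold phiP
  rw [abs_mul, Real.mul_rpow (abs_nonneg _) (abs_nonneg _)]
  ring

lemma phiP_one (p : ℝ) : phiP p 1 = 1 := by simp [phiP]

lemma measurable_phiP (p : ℝ) : Measurable (phiP p) := by
  unfold phiP
  fun_prop

lemma rpow_add_le_two {q : ℝ} (hq : 0 < q) (a b : ℝ) :
    |a + b| ^ q ≤ 2 ^ q * (|a| ^ q + |b| ^ q) := by
  have h1 : |a + b| ≤ 2 * max |a| |b| := by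
    have := abs_add_le a b
    have := le_max_left |a| |b|
    have := le_max_right |a| |b|
    linarith
  have ha := Real.rpow_nonneg (abs_nonneg a) q
  have hb := Real.rpow_nonneg (abs_nonneg b) q
  calc |a + b| ^ q ≤ (2 * max |a| |b|) ^ q := Real.rpow_le_rpow (abs_nonneg _) h1 hq.le
    _ = 2 ^ q * (max |a| |b|) ^ q := Real.mul_rpow (by norm_num) (by positivity)
    _ ≤ 2 ^ q * (|a| ^ q + |b| ^ q) := by
      gcongr
      rcases max_choice |a| |b| with h | h <;> rw [h] <;> linarith

lemma rpow_sub_le_two {q : ℝ} (hq : 0 < q) (a b : ℝ) :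
    |a - b| ^ q ≤ 2 ^ q * (|a| ^ q + |b| ^ q) := by
  have := rpow_add_le_two hq a (-b)
  rwa [abs_neg, ← sub_eq_add_neg] at this

/-- A cheap Young inequality. -/
lemma young_cheap {p η : ℝ} (hp : 1 < p) (hη : 0 < η) (d g : ℝ) :
    |d| ^ (p - 1) * |g| ≤ η ^ (p - 1) * |g| ^ p + η⁻¹ * |d| ^ p := by
  have key : ∀ t : ℝ, |t| ^ p = |t| ^ (p - 1) * |t| := by
    intro t
    rw [← abs_phiP hp, phiP]
    by_cases h : t = 0
    · subst h
      simp [Real.zero_rpow (show p ≠ 0 by linarith)]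
    · have ht : 0 < |t| := abs_pos.mpr h
      rw [abs_mul, abs_of_nonneg (Real.rpow_nonneg ht.le _), show p = (p - 2) + 1 + 1 by ring,
        Real.rpow_add ht, Real.rpow_add ht, Real.rpow_one]
      ring_nf
  have hd := Real.rpow_nonneg (abs_nonneg d) (p - 1)
  have hg := Real.rpow_nonneg (abs_nonneg g) (p - 1)
  have hd' := Real.rpow_nonneg (abs_nonneg d) p
  have hg' := Real.rpow_nonneg (abs_nonneg g) p
  rcases le_total |d| (η * |g|) with h | h
  · have : |d| ^ (p - 1) ≤ η ^ (p - 1) * |g| ^ (p - 1) := by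
      rw [← Real.mul_rpow hη.le (abs_nonneg _)]
      exact Real.rpow_le_rpow (abs_nonneg _) h (by linarith)
    have h2 : |d| ^ (p - 1) * |g| ≤ η ^ (p - 1) * |g| ^ (p - 1) * |g| :=
      mul_le_mul_of_nonneg_right this (abs_nonneg _)
    have h3 : 0 ≤ η⁻¹ * |d| ^ p := by positivity
    rw [key g]
    nlinarith
  · have h1 : |g| ≤ η⁻¹ * |d| := by
      rw [inv_mul_eq_div, le_div_iff₀ hη]
      linarith
    have h2 : |d| ^ (p - 1) * |g| ≤ |d| ^ (p - 1) * (η⁻¹ * |d|) :=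
      mul_le_mul_of_nonneg_left h1 hd
    have h3 : 0 ≤ η ^ (p - 1) * |g| ^ p := by positivity
    rw [key d]
    nlinarith

lemma phiP_diff {p ε : ℝ} (hp : 1 < p) (hε : 0 < ε) :
    ∃ C : ℝ, 0 ≤ C ∧ ∀ a d : ℝ,
      |phiP p (a + d) - phiP p a| ≤ ε * |a| ^ (p - 1) + C * |d| ^ (p - 1) := by
  have hc : ContinuousAt (phiP p) 1 := by
    unfold phiP
    refine ContinuousAt.mul (ContinuousAt.rpow_const ?_ (Or.inl (by simp))) continuousAt_id
    exact continuous_abs.continuousAt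
  obtain ⟨δ, hδ, hδ'⟩ := Metric.continuousAt_iff.mp hc ε hε
  have hq : 0 < p - 1 := by linarith
  refine ⟨2 ^ (p - 1) * ((2 / δ) ^ (p - 1) + 1) + (2 / δ) ^ (p - 1), by positivity, ?_⟩
  intro a d
  have hap := Real.rpow_nonneg (abs_nonneg a) (p - 1)
  have hdp := Real.rpow_nonneg (abs_nonneg d) (p - 1)
  by_cases h : |d| < δ * |a|
  · have ha : a ≠ 0 := by
      rintro rfl
      simp at h
      linarith [abs_nonneg d]
    have ha' : 0 < |a| := abs_pos.mpr ha
    have e1 : a + d = a * (1 + d / a) := by field_simp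
    have h2 := hδ' (x := 1 + d / a) (by
      rw [Real.dist_eq, add_sub_cancel_left, abs_div, div_lt_iff₀ ha']
      exact h)
    rw [Real.dist_eq, phiP_one] at h2
    have e2 : phiP p (a + d) - phiP p a = phiP p a * (phiP p (1 + d / a) - 1) := by
      rw [e1, phiP_mul]
      ring
    rw [e2, abs_mul, abs_phiP hp]
    have := mul_le_mul_of_nonneg_left h2.le hap
    have h3 : 0 ≤ (2 ^ (p - 1) * ((2 / δ) ^ (p - 1) + 1) + (2 / δ) ^ (p - 1)) * |d| ^ (p - 1) := by
      positivity
    linarith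
  · push Not at h
    have h1 : |a| ≤ (2 / δ) * |d| := by
      rw [div_mul_eq_mul_div, le_div_iff₀ hδ]
      linarith [abs_nonneg d]
    have h2 : |a| ^ (p - 1) ≤ (2 / δ) ^ (p - 1) * |d| ^ (p - 1) := by
      rw [← Real.mul_rpow (by positivity) (abs_nonneg _)]
      exact Real.rpow_le_rpow (abs_nonneg _) h1 hq.le
    have h3 : |phiP p (a + d) - phiP p a| ≤ |a + d| ^ (p - 1) + |a| ^ (p - 1) := by
      rw [← abs_phiP hp, ← abs_phiP hp]
      exact abs_sub _ _
    have h4 := rpow_add_le_two hq a d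
    have h5 : (2:ℝ) ^ (p - 1) * (|a| ^ (p - 1) + |d| ^ (p - 1)) ≤
        2 ^ (p - 1) * ((2 / δ) ^ (p - 1) * |d| ^ (p - 1) + |d| ^ (p - 1)) := by
      gcongr
    have h6 : 0 ≤ ε * |a| ^ (p - 1) := by positivity
    nlinarith

lemma phiP_diff_mul {p ε : ℝ} (hp : 1 < p) (hε : 0 < ε) :
    ∃ C : ℝ, 0 ≤ C ∧ ∀ a d g : ℝ,
      |phiP p (a + d) * g - phiP p a * g| ≤
        ε * (|a| ^ (p - 1) * |g| + |g| ^ p) + C * |d| ^ p := by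
  obtain ⟨C, hC, h⟩ := phiP_diff hp hε
  have hq : 0 < p - 1 := by linarith
  -- choose η with C η^(p-1) ≤ ε
  obtain ⟨η, hη, hηC⟩ : ∃ η : ℝ, 0 < η ∧ C * η ^ (p - 1) ≤ ε := by
    refine ⟨(ε / (C + 1)) ^ (1 / (p - 1)), by positivity, ?_⟩
    rw [← Real.rpow_mul (by positivity), one_div_mul_cancel hq.ne', Real.rpow_one,
      mul_div_assoc', div_le_iff₀ (by positivity)]
    nlinarith
  refine ⟨C * η⁻¹, by positivity, ?_⟩
  intro a d g
  rw [← sub_mul, abs_mul]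
  have h1 := mul_le_mul_of_nonneg_right (h a d) (abs_nonneg g)
  have h2 := mul_le_mul_of_nonneg_left (young_cheap hp hη d g) hC
  have h3 := mul_le_mul_of_nonneg_right hηC (Real.rpow_nonneg (abs_nonneg g) p)
  nlinarith

/-- The general convergence lemma. -/
lemma general_conv {α : Type*} [MeasurableSpace α] {μ : Measure α} {p : ℝ} (hp : 1 < p)
    (F G W : α → ℝ) (D : ℕ → α → ℝ)
    (hF : AEMeasurable F μ) (hG : AEMeasurable G μ) (hW : AEMeasurable W μ)
    (hD : ∀ j, AEMeasurable (D j) μ) (hW0 : ∀ x, 0 ≤ W x)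
    (iF : Integrable (fun x => |F x| ^ (p - 1) * |G x| * W x) μ)
    (iG : Integrable (fun x => |G x| ^ p * W x) μ)
    (iD : ∀ j, Integrable (fun x => |D j x| ^ p * W x) μ)
    (hlim : Tendsto (fun j => ∫ x, |D j x| ^ p * W x ∂μ) atTop (𝓝 0)) :
    Integrable (fun x => phiP p (F x) * G x * W x) μ ∧
    (∀ j, Integrable (fun x => phiP p (F x + D j x) * G x * W x) μ) ∧
    Tendsto (fun j => ∫ x, phiP p (F x + D j x) * G x * W x ∂μ) atTop
      (𝓝 (∫ x, phiP p (F x) * G x * W x ∂μ)) := by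
  have I0 : Integrable (fun x => phiP p (F x) * G x * W x) μ := by
    refine iF.mono' ?_ ?_
    · exact (((measurable_phiP p).comp_aemeasurable hF).mul hG |>.mul hW).aestronglyMeasurable
    · refine Eventually.of_forall fun x => ?_
      rw [Real.norm_eq_abs, abs_mul, abs_mul, abs_phiP hp, abs_of_nonneg (hW0 x)]
  have mj : ∀ j, AEStronglyMeasurable (fun x => phiP p (F x + D j x) * G x * W x) μ := fun j =>
    (((measurable_phiP p).comp_aemeasurable (hF.add (hD j))).mul hG |>.mul hW).aestronglyMeasurable
  have bnd : ∀ ε : ℝ, 0 < ε → ∃ C : ℝ, 0 ≤ C ∧ ∀ j x,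
      |phiP p (F x + D j x) * G x * W x - phiP p (F x) * G x * W x| ≤
        ε * (|F x| ^ (p - 1) * |G x| * W x + |G x| ^ p * W x) + C * (|D j x| ^ p * W x) := by
    intro ε hε
    obtain ⟨C, hC, h⟩ := phiP_diff_mul hp hε
    refine ⟨C, hC, fun j x => ?_⟩
    rw [← sub_mul, abs_mul, abs_of_nonneg (hW0 x)]
    have := mul_le_mul_of_nonneg_right (h (F x) (D j x) (G x)) (hW0 x)
    linarith
  have ib : ∀ (ε C : ℝ) j, Integrable (fun x =>
      ε * (|F x| ^ (p - 1) * |G x| * W x + |G x| ^ p * W x) + C * (|D j x| ^ p * W x)) μ :=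
    fun ε C j => ((iF.add iG).const_mul ε).add ((iD j).const_mul C)
  have Ij : ∀ j, Integrable (fun x => phiP p (F x + D j x) * G x * W x) μ := by
    intro j
    obtain ⟨C, hC, h⟩ := bnd 1 one_pos
    have : Integrable (fun x =>
        phiP p (F x + D j x) * G x * W x - phiP p (F x) * G x * W x) μ :=
      (ib 1 C j).mono' ((mj j).sub I0.aestronglyMeasurable) (Eventually.of_forall (h j))
    have h2 := this.add I0
    refine h2.congr (Eventually.of_forall fun x => ?_)
    simp
  refine ⟨I0, Ij, ?_⟩
  set M : ℝ := ∫ x, (|F x| ^ (p - 1) * |G x| * W x + |G x| ^ p * W x) ∂μ with hM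
  have hM0 : 0 ≤ M := by
    refine integral_nonneg fun x => ?_
    have := hW0 x
    simp only [Pi.zero_apply]
    positivity
  rw [Metric.tendsto_atTop]
  intro ε hε
  obtain ⟨C, hC, h⟩ := bnd (ε / (2 * (M + 1))) (by positivity)
  have hl2 : Tendsto (fun j => C * ∫ x, |D j x| ^ p * W x ∂μ) atTop (𝓝 0) := by
    simpa using hlim.const_mul C
  obtain ⟨N, hN⟩ := Metric.tendsto_atTop.mp hl2 (ε / 2) (by positivity)
  refine ⟨N, fun j hj => ?_⟩
  rw [Real.dist_eq, ← integral_sub (Ij j) I0]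
  have h1 := hN j hj
  rw [Real.dist_eq, sub_zero] at h1
  have h2 : |∫ x, (phiP p (F x + D j x) * G x * W x - phiP p (F x) * G x * W x) ∂μ| ≤
      ε / (2 * (M + 1)) * M + C * ∫ x, |D j x| ^ p * W x ∂μ := by
    have e : ∀ ε' : ℝ, ∫ x, (ε' * (|F x| ^ (p - 1) * |G x| * W x + |G x| ^ p * W x) +
        C * (|D j x| ^ p * W x)) ∂μ = ε' * M + C * ∫ x, |D j x| ^ p * W x ∂μ := by
      intro ε'
      have i1 : Integrable (fun x => ε' * (|F x| ^ (p - 1) * |G x| * W x + |G x| ^ p * W x)) μ :=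
        (iF.add iG).const_mul _
      rw [integral_add i1 ((iD j).const_mul C), integral_const_mul, integral_const_mul]
    rw [← e]
    rw [← Real.norm_eq_abs]
    refine norm_integral_le_of_norm_le (ib _ C j) (Eventually.of_forall fun x => ?_)
    rw [Real.norm_eq_abs]
    exact h j x
  have h3 : ε / (2 * (M + 1)) * M ≤ ε / 2 := by
    rw [div_mul_eq_mul_div, div_le_div_iff₀ (by positivity) (by positivity)]
    nlinarith
  linarith [le_abs_self (C * ∫ x, |D j x| ^ p * W x ∂μ)]

lemma ae_kernel {n : ℕ} {s p Λ : ℝ} (hs0 : 0 < s) (hp : 1 < p) (hn : 1 ≤ n) (hΛ : 1 ≤ Λ)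
    {K : Euc n → Euc n → ℝ} (hK : IsKernel n s p Λ K) (A B : Set (Euc n)) :
    ∀ᵐ q ∂((volume.restrict A).prod (volume.restrict B) : Measure (Euc n × Euc n)),
      0 < ‖q.1 - q.2‖ ∧ K q.1 q.2 ≤ Λ / ‖q.1 - q.2‖ ^ ((n : ℝ) + s * p) := by
  rw [Measure.prod_restrict]
  refine ae_restrict_of_ae ?_
  have h := hK.2.2.2
  change ∀ᵐ q ∂((volume : Measure (Euc n)).prod volume), _ at h
  filter_upwards [h] with q hq
  have hpos : (0:ℝ) < (n : ℝ) + s * p := by positivity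
  have h0 : 0 < ‖q.1 - q.2‖ := by
    rcases (norm_nonneg (q.1 - q.2)).eq_or_lt with h' | h'
    · exfalso
      have := hq.1
      rw [← h', Real.zero_rpow hpos.ne', mul_zero] at this
      have : 0 < Λ⁻¹ := by positivity
      linarith
    · exact h'
  refine ⟨h0, ?_⟩
  rw [le_div_iff₀ (by positivity)]
  exact hq.2

lemma memW_sub {n : ℕ} {s p : ℝ} (hp : 1 < p) {D : Set (Euc n)} {u v : Euc n → ℝ}
    (hu : MemW n s p D u) (hv : MemW n s p D v) : MemW n s p D (fun x => u x - v x) := by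
  obtain ⟨mu, iu, du⟩ := hu
  obtain ⟨mv, iv, dv⟩ := hv
  have hp0 : 0 < p := by linarith
  refine ⟨mu.sub mv, ?_, ?_⟩
  · refine ((iu.add iv).const_mul (2 ^ p)).mono' ?_ ?_
    · exact ((mu.sub mv).abs.pow_const p).aestronglyMeasurable
    · refine Eventually.of_forall fun x => ?_
      rw [Real.norm_eq_abs, abs_of_nonneg (Real.rpow_nonneg (abs_nonneg _) _)]
      exact rpow_sub_le_two hp0 _ _
  · refine ((du.add dv).const_mul (2 ^ p)).mono' ?_ ?_
    · have m1 := (mu.sub mv).comp_fst (ν := volume.restrict D)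
      have m2 := (mu.sub mv).comp_snd (μ := volume.restrict D)
      refine AEMeasurable.aestronglyMeasurable ?_
      refine ((m1.sub m2).abs.pow_const p).div (Measurable.aemeasurable ?_)
      fun_prop
    · refine Eventually.of_forall fun q => ?_
      have hnn : 0 ≤ ‖q.1 - q.2‖ ^ ((n : ℝ) + s * p) := Real.rpow_nonneg (norm_nonneg _) _
      rw [Real.norm_eq_abs, abs_of_nonneg (div_nonneg (Real.rpow_nonneg (abs_nonneg _) _) hnn)]
      simp only [Pi.add_apply]
      rw [← add_div, mul_div_assoc']
      gcongr
      have := rpow_sub_le_two hp0 (u q.1 - u q.2) (v q.1 - v q.2)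
      rwa [show u q.1 - u q.2 - (v q.1 - v q.2) = u q.1 - v q.1 - (u q.2 - v q.2) by ring] at this

set_option maxHeartbeats 1000000 in
lemma first_part
    {n : ℕ} {s p Λ : ℝ} (hn : 1 ≤ n) (hs0 : 0 < s) (hp : 1 < p)
    (hΛ : 1 ≤ Λ) {K : Euc n → Euc n → ℝ} (hK : IsKernel n s p Λ K)
    {Ω' : Set (Euc n)} {u v : Euc n → ℝ} {uj : ℕ → Euc n → ℝ}
    (hu : MemW n s p Ω' u) (huj : ∀ j, MemW n s p Ω' (uj j)) (hv : MemW n s p Ω' v)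
    (hconv : Tendsto (fun j => ∫ x in Ω', ∫ y in Ω',
      |(uj j x - u x) - (uj j y - u y)| ^ p / ‖x - y‖ ^ ((n : ℝ) + s * p)) atTop (𝓝 0)) :
    Tendsto (fun j => ∫ x in Ω', ∫ y in Ω', Lf p (uj j x) (uj j y) * (v x - v y) * K x y) atTop
      (𝓝 (∫ x in Ω', ∫ y in Ω', Lf p (u x) (u y) * (v x - v y) * K x y)) := by
  set μ : Measure (Euc n × Euc n) := (volume.restrict Ω').prod (volume.restrict Ω') with hμ
  have hp0 : 0 < p := by linarith
  have hKm : AEMeasurable (fun q : Euc n × Euc n => K q.1 q.2) μ := hK.1.aemeasurable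
  have hae := ae_kernel hs0 hp hn hΛ hK Ω' Ω'
  have md : ∀ w : Euc n → ℝ, MemW n s p Ω' w →
      AEMeasurable (fun q : Euc n × Euc n => w q.1 - w q.2) μ := fun w hw =>
    (hw.1.comp_fst (ν := volume.restrict Ω')).sub (hw.1.comp_snd (μ := volume.restrict Ω'))
  have bd : ∀ w : Euc n → ℝ, ∀ᵐ q ∂μ, |w q.1 - w q.2| ^ p * K q.1 q.2 ≤
      Λ * (|w q.1 - w q.2| ^ p / ‖q.1 - q.2‖ ^ ((n : ℝ) + s * p)) := by
    intro w
    filter_upwards [hae] with q hq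
    have := mul_le_mul_of_nonneg_left hq.2 (Real.rpow_nonneg (abs_nonneg (w q.1 - w q.2)) p)
    refine this.trans (le_of_eq ?_)
    ring
  have ii : ∀ w : Euc n → ℝ, MemW n s p Ω' w →
      Integrable (fun q : Euc n × Euc n => |w q.1 - w q.2| ^ p * K q.1 q.2) μ := by
    intro w hw
    refine (hw.2.2.const_mul Λ).mono' ?_ ?_
    · exact (((md w hw).abs.pow_const p).mul hKm).aestronglyMeasurable
    · filter_upwards [bd w] with q hq
      rwa [Real.norm_eq_abs, abs_of_nonneg
        (mul_nonneg (Real.rpow_nonneg (abs_nonneg _) _) (hK.2.2.1 _ _))]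
  have hD : ∀ j, MemW n s p Ω' (fun x => uj j x - u x) := fun j => memW_sub hp (huj j) hu
  have key := general_conv (μ := μ) hp (fun q => u q.1 - u q.2) (fun q => v q.1 - v q.2)
    (fun q => K q.1 q.2) (fun j q => (uj j q.1 - u q.1) - (uj j q.2 - u q.2))
    (md u hu) (md v hv) hKm (fun j => md _ (hD j)) (fun q => hK.2.2.1 _ _)
    ?_ (ii v hv) (fun j => ii _ (hD j)) ?_
  · obtain ⟨k1, k2, k3⟩ := key
    have e : ∀ j (q : Euc n × Euc n), u q.1 - u q.2 + (uj j q.1 - u q.1 - (uj j q.2 - u q.2)) =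
        uj j q.1 - uj j q.2 := fun j q => by ring
    simp only [e] at k2 k3
    have k3' := k3
    rw [integral_prod _ k1] at k3'
    exact k3'.congr fun j => integral_prod _ (k2 j)
  · refine ((ii u hu).add (ii v hv)).mono' ?_ ?_
    · exact ((((md u hu).abs.pow_const (p - 1)).mul (md v hv).abs).mul hKm).aestronglyMeasurable
    · refine Eventually.of_forall fun q => ?_
      have hk := hK.2.2.1 q.1 q.2
      have := young_cheap hp one_pos (u q.1 - u q.2) (v q.1 - v q.2)
      rw [Real.one_rpow, inv_one, one_mul, one_mul] at this
      have := mul_le_mul_of_nonneg_right this hk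
      rw [Real.norm_eq_abs, abs_of_nonneg (by positivity)]
      simp only [Pi.add_apply]
      linarith
  · have hl := hconv.const_mul Λ
    rw [mul_zero] at hl
    refine squeeze_zero (fun j => ?_) (fun j => ?_) hl
    · refine integral_nonneg fun q => ?_
      exact mul_nonneg (Real.rpow_nonneg (abs_nonneg _) _) (hK.2.2.1 _ _)
    · have e := integral_prod _ (hD j).2.2
      rw [← e, ← integral_const_mul]
      exact integral_mono_ae (ii _ (hD j)) ((hD j).2.2.const_mul Λ) (bd (fun x => uj j x - u x))

lemma integrable_weight {n : ℕ} {t : ℝ} (ht : 0 < t) (z : Euc n) {r : ℝ} (hr : 0 < r) :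
    IntegrableOn (fun x : Euc n => ‖x - z‖ ^ (-((n : ℝ) + t))) (ball z r)ᶜ volume := by
  have h1 : Integrable (fun x : Euc n => (1 + ‖x‖) ^ (-((n : ℝ) + t))) volume := by
    refine integrable_one_add_norm ?_
    simp [ht]
  have h2 := (h1.comp_sub_right z).const_mul ((1 + 1 / r) ^ ((n : ℝ) + t))
  refine h2.integrableOn.mono' ?_ ?_
  · refine Measurable.aestronglyMeasurable ?_
    fun_prop
  · refine (ae_restrict_iff' measurableSet_ball.compl).mpr (Eventually.of_forall fun x hx => ?_)
    have hxr : r ≤ ‖x - z‖ := by simpa [dist_eq_norm] using hx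
    have hx0 : 0 < ‖x - z‖ := by linarith
    have hnt : 0 ≤ (n : ℝ) + t := by positivity
    rw [Real.norm_eq_abs, abs_of_nonneg (Real.rpow_nonneg hx0.le _), Real.rpow_neg hx0.le,
      Real.rpow_neg (by positivity), ← div_eq_mul_inv, le_div_iff₀ (by positivity),
      inv_mul_le_iff₀ (by positivity), ← Real.mul_rpow hx0.le (by positivity)]
    refine Real.rpow_le_rpow (by positivity) ?_ hnt
    have : 1 ≤ ‖x - z‖ / r := by rwa [le_div_iff₀ hr, one_mul]
    have e : ‖x - z‖ * (1 + 1 / r) = ‖x - z‖ + ‖x - z‖ / r := by ring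
    linarith

lemma dist_lower {n : ℕ} {Ω Ω' : Set (Euc n)} (hΩ'o : IsOpen Ω')
    (hΩb : Bornology.IsBounded Ω) (hΩΩ' : closure Ω ⊆ Ω') {z : Euc n} (hz : z ∈ Ω) :
    ∃ c : ℝ, 0 < c ∧ ∀ x ∈ Ω, ∀ y ∈ Ω'ᶜ, ‖y - z‖ ≤ c * ‖y - x‖ := by
  have hcomp : IsCompact (closure Ω) := hΩb.isCompact_closure
  obtain ⟨δ, hδ, hsub⟩ := hcomp.exists_thickening_subset_open hΩ'o hΩΩ'
  obtain ⟨R, hR⟩ := hΩb.subset_closedBall z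
  have hR0 : 0 ≤ R := by
    have := hR hz
    simpa using this
  refine ⟨1 + R / δ, by positivity, fun x hx y hy => ?_⟩
  have h1 : δ ≤ ‖y - x‖ := by
    by_contra hlt
    push Not at hlt
    refine hy (hsub ?_)
    rw [Metric.mem_thickening_iff]
    exact ⟨x, subset_closure hx, by rwa [dist_eq_norm]⟩
  have h2 : ‖x - z‖ ≤ R := by
    have := hR hx
    rwa [mem_closedBall, dist_eq_norm] at this
  have h3 : ‖y - z‖ ≤ ‖y - x‖ + ‖x - z‖ := norm_sub_le_norm_sub_add_norm_sub _ _ _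
  have h4 : R ≤ R / δ * ‖y - x‖ := by
    rw [div_mul_eq_mul_div, le_div_iff₀ hδ]
    gcongr
  linarith

lemma second_part
    {n : ℕ} {s p Λ : ℝ} (hn : 1 ≤ n) (hs0 : 0 < s) (hp : 1 < p)
    (hΛ : 1 ≤ Λ) {K : Euc n → Euc n → ℝ} (hK : IsKernel n s p Λ K)
    {Ω Ω' : Set (Euc n)} (hΩo : IsOpen Ω) (hΩ'o : IsOpen Ω')
    (hΩb : Bornology.IsBounded Ω) (hΩΩ' : closure Ω ⊆ Ω')
    {g : Euc n → ℝ} (hgt : MemTail n s p g) {u v : Euc n → ℝ} {uj : ℕ → Euc n → ℝ}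
    (hu : MemW n s p Ω' u) (huj : ∀ j, MemW n s p Ω' (uj j)) (hv : MemW n s p Ω' v)
    (hconv : Tendsto (fun j => ∫ x in Ω', |uj j x - u x| ^ p) atTop (𝓝 0)) :
    Tendsto (fun j => ∫ y in Ω'ᶜ, ∫ x in Ω, Lf p (uj j x) (g y) * v x * K x y) atTop
      (𝓝 (∫ y in Ω'ᶜ, ∫ x in Ω, Lf p (u x) (g y) * v x * K x y)) := by
  rcases Ω.eq_empty_or_nonempty with hE | ⟨z, hz⟩
  · subst hE
    simp
  have hsub : Ω ⊆ Ω' := subset_closure.trans hΩΩ'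
  obtain ⟨r, hr, hball⟩ := Metric.isOpen_iff.mp hΩ'o z (hsub hz)
  obtain ⟨c, hc, hdist⟩ := dist_lower hΩ'o hΩb hΩΩ' hz
  have hp0 : 0 < p := by linarith
  have hsp : 0 < s * p := by positivity
  have hnt : 0 ≤ (n : ℝ) + s * p := by positivity
  set ν₁ : Measure (Euc n) := volume.restrict Ω'ᶜ with hν₁
  set ν₂ : Measure (Euc n) := volume.restrict Ω with hν₂
  set μ : Measure (Euc n × Euc n) := ν₁.prod ν₂ with hμ
  set w : Euc n → ℝ := fun y => ‖y - z‖ ^ (-((n : ℝ) + s * p)) with hw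
  have hw0 : ∀ y, 0 ≤ w y := fun y => Real.rpow_nonneg (norm_nonneg _) _
  have hcs : Ω'ᶜ ⊆ (ball z r)ᶜ := Set.compl_subset_compl.mpr hball
  have iw : Integrable w ν₁ := (integrable_weight hsp z hr).mono_set hcs
  have igw : Integrable (fun y => |g y| ^ (p - 1) * w y) ν₁ := (hgt.2.2 z r hr).mono_set hcs
  set C : ℝ := Λ * c ^ ((n : ℝ) + s * p) with hC
  have hC0 : 0 ≤ C := by positivity
  have hle : ν₂ ≤ volume.restrict Ω' := Measure.restrict_mono hsub le_rfl
  have hfin : IsFiniteMeasure ν₂ := ⟨by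
    rw [hν₂, Measure.restrict_apply_univ]
    exact hΩb.measure_lt_top⟩
  have hKb : ∀ᵐ q ∂μ, K q.1 q.2 ≤ C * w q.1 := by
    have hmem : ∀ᵐ q ∂μ, q ∈ Ω'ᶜ ×ˢ Ω := by
      rw [hμ, hν₁, hν₂, Measure.prod_restrict]
      exact ae_restrict_mem (hΩ'o.measurableSet.compl.prod hΩo.measurableSet)
    filter_upwards [ae_kernel hs0 hp hn hΛ hK Ω'ᶜ Ω, hmem] with q hq hm
    refine hq.2.trans ?_
    have hd := hdist q.2 hm.2 q.1 hm.1
    have hyz : 0 < ‖q.1 - z‖ := by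
      have := hcs hm.1
      have : r ≤ ‖q.1 - z‖ := by simpa [dist_eq_norm] using this
      linarith
    simp only [hw, hC]
    rw [Real.rpow_neg hyz.le, mul_assoc, div_eq_mul_inv]
    refine mul_le_mul_of_nonneg_left ?_ (by linarith)
    have h0 := hq.1
    rw [← div_eq_mul_inv, inv_le_iff_one_le_mul₀ (by positivity), div_mul_eq_mul_div,
      one_le_div (by positivity), ← Real.mul_rpow hc.le h0.le]
    exact Real.rpow_le_rpow hyz.le hd hnt
  have hKm : AEMeasurable (fun q : Euc n × Euc n => K q.1 q.2) μ := hK.1.aemeasurable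
  have m2 : ∀ f : Euc n → ℝ, MemW n s p Ω' f → AEMeasurable f ν₂ :=
    fun f hf => hf.1.mono_measure hle
  have m2' : ∀ f : Euc n → ℝ, MemW n s p Ω' f →
      AEMeasurable (fun q : Euc n × Euc n => f q.2) μ := fun f hf => (m2 f hf).comp_snd
  have mg : AEMeasurable (fun q : Euc n × Euc n => g q.1) μ :=
    (hgt.1.mono_measure Measure.restrict_le_self : AEMeasurable g ν₁).comp_fst
  have ip : ∀ f : Euc n → ℝ, MemW n s p Ω' f → Integrable (fun x => |f x| ^ p) ν₂ :=
    fun f hf => hf.2.1.mono_set hsub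
  have ipw : ∀ f : Euc n → ℝ, MemW n s p Ω' f →
      Integrable (fun q : Euc n × Euc n => w q.1 * |f q.2| ^ p) μ :=
    fun f hf => iw.mul_prod (ip f hf)
  have bd : ∀ f : Euc n → ℝ, ∀ᵐ q ∂μ, |f q.2| ^ p * K q.1 q.2 ≤ C * (w q.1 * |f q.2| ^ p) := by
    intro f
    filter_upwards [hKb] with q hq
    have := mul_le_mul_of_nonneg_left hq (Real.rpow_nonneg (abs_nonneg (f q.2)) p)
    refine this.trans (le_of_eq ?_)
    ring
  have ii : ∀ f : Euc n → ℝ, MemW n s p Ω' f →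
      Integrable (fun q : Euc n × Euc n => |f q.2| ^ p * K q.1 q.2) μ := by
    intro f hf
    refine ((ipw f hf).const_mul C).mono' ?_ ?_
    · exact (((m2' f hf).abs.pow_const p).mul hKm).aestronglyMeasurable
    · filter_upwards [bd f] with q hq
      rwa [Real.norm_eq_abs, abs_of_nonneg
        (mul_nonneg (Real.rpow_nonneg (abs_nonneg _) _) (hK.2.2.1 _ _))]
  have iv1 : Integrable (fun x => |v x|) ν₂ := by
    refine ((integrable_const (1:ℝ)).add (ip v hv)).mono' (m2 v hv).abs.aestronglyMeasurable ?_
    refine Eventually.of_forall fun x => ?_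
    rw [Real.norm_eq_abs, abs_abs]
    have := young_cheap hp one_pos 1 (v x)
    simp at this
    simp only [Pi.add_apply]
    linarith
  have hD : ∀ j, MemW n s p Ω' (fun x => uj j x - u x) := fun j => memW_sub hp (huj j) hu
  have key := general_conv (μ := μ) hp (fun q => u q.2 - g q.1) (fun q => v q.2)
    (fun q => K q.1 q.2) (fun j q => uj j q.2 - u q.2)
    ((m2' u hu).sub mg) (m2' v hv) hKm (fun j => m2' _ (hD j)) (fun q => hK.2.2.1 _ _)
    ?_ (ii v hv) (fun j => ii _ (hD j)) ?_
  · obtain ⟨k1, k2, k3⟩ := key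
    have e : ∀ j (q : Euc n × Euc n), u q.2 - g q.1 + (uj j q.2 - u q.2) =
        uj j q.2 - g q.1 := fun j q => by ring
    simp only [e] at k2 k3
    have k3' := k3
    rw [integral_prod _ k1] at k3'
    replace k3' := k3'.congr fun j => integral_prod _ (k2 j)
    have hsym : ∀ x y, K x y = K y x := hK.2.1
    have swap : ∀ f : Euc n → ℝ, (∫ y in Ω'ᶜ, ∫ x in Ω, Lf p (f x) (g y) * v x * K x y) =
        ∫ y, ∫ x, phiP p (f x - g y) * v x * K y x ∂ν₂ ∂ν₁ := by
      intro f
      refine integral_congr_ae (Eventually.of_forall fun y => ?_)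
      refine integral_congr_ae (Eventually.of_forall fun x => ?_)
      change Lf p (f x) (g y) * v x * K x y = phiP p (f x - g y) * v x * K y x
      rw [hsym x y]
      rfl
    rw [swap u]
    exact k3'.congr fun j => (swap (uj j)).symm
  · have j1 := ipw u hu
    have j2 := ipw v hv
    have j3 : Integrable (fun q : Euc n × Euc n => |g q.1| ^ (p - 1) * w q.1 * |v q.2|) μ :=
      igw.mul_prod iv1
    refine (((j1.add j2).add j3).const_mul (2 ^ (p - 1) * C)).mono' ?_ ?_
    · exact (((((m2' u hu).sub mg).abs.pow_const (p - 1)).mul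
        (m2' v hv).abs).mul hKm).aestronglyMeasurable
    · filter_upwards [hKb] with q hq
      have hk := hK.2.2.1 q.1 q.2
      rw [Real.norm_eq_abs, abs_of_nonneg (by positivity)]
      simp only [Pi.add_apply]
      have y1 := young_cheap hp one_pos (u q.2) (v q.2)
      rw [Real.one_rpow, inv_one, one_mul, one_mul] at y1
      have y2 := rpow_sub_le_two (show 0 < p - 1 by linarith) (u q.2) (g q.1)
      have hwq := hw0 q.1
      calc |u q.2 - g q.1| ^ (p - 1) * |v q.2| * K q.1 q.2
          ≤ (2 ^ (p - 1) * (|u q.2| ^ (p - 1) + |g q.1| ^ (p - 1))) * |v q.2| * (C * w q.1) := by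
            gcongr
        _ = 2 ^ (p - 1) * C * (w q.1 * (|u q.2| ^ (p - 1) * |v q.2|) +
              |g q.1| ^ (p - 1) * w q.1 * |v q.2|) := by ring
        _ ≤ 2 ^ (p - 1) * C * (w q.1 * (|v q.2| ^ p + |u q.2| ^ p) +
              |g q.1| ^ (p - 1) * w q.1 * |v q.2|) := by gcongr
        _ = _ := by ring
  · have hl := hconv.const_mul (C * ∫ y, w y ∂ν₁)
    rw [mul_zero] at hl
    have hwi : 0 ≤ ∫ y, w y ∂ν₁ := integral_nonneg hw0
    refine squeeze_zero (fun j => ?_) (fun j => ?_) hl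
    · refine integral_nonneg fun q => ?_
      exact mul_nonneg (Real.rpow_nonneg (abs_nonneg _) _) (hK.2.2.1 _ _)
    · calc ∫ q, |uj j q.2 - u q.2| ^ p * K q.1 q.2 ∂μ
          ≤ ∫ q, C * (w q.1 * |uj j q.2 - u q.2| ^ p) ∂μ :=
            integral_mono_ae (ii _ (hD j)) ((ipw _ (hD j)).const_mul C) (bd (fun x => uj j x - u x))
        _ = C * ((∫ y, w y ∂ν₁) * ∫ x, |uj j x - u x| ^ p ∂ν₂) := by
            rw [integral_const_mul, hμ,
              integral_prod_mul (μ := ν₁) (ν := ν₂) w (fun x => |uj j x - u x| ^ p)]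
        _ ≤ C * ((∫ y, w y ∂ν₁) * ∫ x in Ω', |uj j x - u x| ^ p) := by
            gcongr
            · exact Eventually.of_forall fun x => Real.rpow_nonneg (abs_nonneg _) _
            · exact (hD j).2.1
        _ = _ := by ring


/-- Lemma 3.4 (weak continuity): if `u_j → u` in `W^{s,p}(Ω')` within `K_{g,h}(Ω,Ω')`,
then `A u_j (v) → A u (v)` for every `v ∈ W^{s,p}(Ω')`. -/
theorem A_weakly_continuous
    (n : ℕ) (s p Λ : ℝ) (hn : 1 ≤ n) (hs0 : 0 < s) (hs1 : s < 1) (hp : 1 < p)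
    (hΛ : 1 ≤ Λ) (K : Euc n → Euc n → ℝ) (hK : IsKernel n s p Λ K)
    (Ω Ω' : Set (Euc n)) (hΩo : IsOpen Ω) (hΩ'o : IsOpen Ω')
    (hΩb : Bornology.IsBounded Ω) (hΩ'b : Bornology.IsBounded Ω') (hΩΩ' : closure Ω ⊆ Ω')
    (g : Euc n → ℝ) (h : Euc n → EReal)
    (hg : MemW n s p Ω' g) (hgt : MemTail n s p g)
    (hne : (obstacleSet n s p Ω Ω' g h).Nonempty)
    (u : Euc n → ℝ) (uj : ℕ → Euc n → ℝ)
    (hu : u ∈ obstacleSet n s p Ω Ω' g h)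
    (huj : ∀ j, uj j ∈ obstacleSet n s p Ω Ω' g h)
    (hconv : Filter.Tendsto (fun j => sobNorm n s p Ω' (fun x => uj j x - u x))
      Filter.atTop (nhds 0)) :
    ∀ v : Euc n → ℝ, MemW n s p Ω' v →
      Filter.Tendsto (fun j => Aop n p Ω Ω' g K (uj j) v) Filter.atTop
        (nhds (Aop n p Ω Ω' g K u v)) := by
  intro v hv
  have hp0 : 0 < p := by linarith
  have a0 : ∀ j, 0 ≤ ∫ x in Ω', |uj j x - u x| ^ p := fun j =>
    integral_nonneg fun x => Real.rpow_nonneg (abs_nonneg _) _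
  have b0 : ∀ j, 0 ≤ ∫ x in Ω', ∫ y in Ω',
      |(uj j x - u x) - (uj j y - u y)| ^ p / ‖x - y‖ ^ ((n : ℝ) + s * p) := fun j =>
    integral_nonneg fun x => integral_nonneg fun y =>
      div_nonneg (Real.rpow_nonneg (abs_nonneg _) _) (Real.rpow_nonneg (norm_nonneg _) _)
  have root : ∀ f : ℕ → ℝ, (∀ j, 0 ≤ f j) → Tendsto (fun j => f j ^ (1 / p)) atTop (𝓝 0) →
      Tendsto f atTop (𝓝 0) := by
    intro f hf h
    have h2 := h.rpow_const (p := p) (Or.inr hp0.le)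
    rw [Real.zero_rpow hp0.ne'] at h2
    refine h2.congr fun j => ?_
    rw [← Real.rpow_mul (hf j), one_div_mul_cancel hp0.ne', Real.rpow_one]
  have ta := root _ a0 (squeeze_zero (fun j => Real.rpow_nonneg (a0 j) _)
    (fun j => le_add_of_nonneg_right (Real.rpow_nonneg (b0 j) _)) hconv)
  have tb := root _ b0 (squeeze_zero (fun j => Real.rpow_nonneg (b0 j) _)
    (fun j => le_add_of_nonneg_left (Real.rpow_nonneg (a0 j) _)) hconv)
  exact (first_part hn hs0 hp hΛ hK hu.1 (fun j => (huj j).1) hv tb).add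
    ((second_part hn hs0 hp hΛ hK hΩo hΩ'o hΩb hΩΩ' hgt hu.1 (fun j => (huj j).1) hv
      ta).const_mul 2)
end

section
/- There exists a solution u ∈ K_{g,h}(Ω,Ω') to the obstacle problem in K_{g,h}(Ω,Ω'), i.e. A u(v − u) ≥ 0 for all v ∈ K_{g,h}(Ω,Ω'), and this solution is unique up to sets of measure zero: if u₁ and u₂ both solve the obstacle problem in K_{g,h}(Ω,Ω'), then u₁ = u₂ almost everywhere. -/
open MeasureTheory Metric Filter
open scoped ENNReal Topology

namespace Obst

/-- `|t|^{p-2} t`. -/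
noncomputable def Lg (p t : ℝ) : ℝ := |t| ^ (p - 2) * t

lemma abs_Lg {p : ℝ} (hp : 1 < p) (t : ℝ) : |Lg p t| = |t| ^ (p - 1) := by
  unfold Lg
  rcases eq_or_ne t 0 with rfl | ht
  · simp [Real.zero_rpow (by linarith : p - 1 ≠ 0)]
  · have h : 0 < |t| := abs_pos.mpr ht
    rw [abs_mul, abs_of_nonneg (by positivity), ← Real.rpow_add_one h.ne']
    congr 1; ring

lemma phi_cont {p : ℝ} (hp : 1 < p) : Continuous (fun t : ℝ => |t| ^ p) :=
  continuous_abs.rpow_const (fun _ => Or.inr (by linarith))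

lemma phi1_cont {p : ℝ} (hp : 1 < p) : Continuous (fun t : ℝ => |t| ^ (p - 1)) :=
  continuous_abs.rpow_const (fun _ => Or.inr (by linarith))

lemma Lg_meas (p : ℝ) : Measurable (Lg p) := by
  unfold Lg; fun_prop

lemma phi_convex {p : ℝ} (hp : 1 < p) (a b t : ℝ) (h0 : 0 ≤ t) (h1 : t ≤ 1) :
    |a + t * b| ^ p ≤ (1 - t) * |a| ^ p + t * |a + b| ^ p := by
  have h := (convexOn_rpow hp.le).2 (Set.mem_Ici.mpr (abs_nonneg a))
    (Set.mem_Ici.mpr (abs_nonneg (a + b)))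
    (show 0 ≤ 1 - t by linarith) h0 (by ring)
  simp only [smul_eq_mul] at h
  refine le_trans (Real.rpow_le_rpow (abs_nonneg _) ?_ (by linarith)) h
  have : a + t * b = (1 - t) * a + t * (a + b) := by ring
  rw [this]
  refine (abs_add_le _ _).trans ?_
  rw [abs_mul, abs_mul, abs_of_nonneg h0, abs_of_nonneg (by linarith : 0 ≤ 1 - t)]

lemma phi_mid {p : ℝ} (hp : 1 < p) {a b : ℝ} (hab : a ≠ b) :
    0 < |a| ^ p + |b| ^ p - 2 * |(a + b) / 2| ^ p := by
  have hp0 : (0:ℝ) < p := by linarith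
  by_cases h : |a| = |b|
  · rcases abs_eq_abs.mp h with h' | h'
    · exact absurd h' hab
    · subst h'
      have hb : b ≠ 0 := by rintro rfl; simp at hab
      have : 0 < |b| ^ p := Real.rpow_pos_of_pos (abs_pos.mpr hb) _
      simp [Real.zero_rpow hp0.ne', this]
  · have h2 := (strictConvexOn_rpow hp).2 (Set.mem_Ici.mpr (abs_nonneg a))
      (Set.mem_Ici.mpr (abs_nonneg b)) h
      (show (0:ℝ) < 1/2 by norm_num) (show (0:ℝ) < 1/2 by norm_num) (by norm_num)
    simp only [smul_eq_mul] at h2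
    have h3 : |(a + b) / 2| ^ p ≤ (1/2 * |a| + 1/2 * |b|) ^ p := by
      refine Real.rpow_le_rpow (abs_nonneg _) ?_ hp0.le
      rw [abs_div, abs_two]
      linarith [abs_add_le a b]
    linarith

lemma phi_mid_nonneg {p : ℝ} (hp : 1 < p) (a b : ℝ) :
    0 ≤ |a| ^ p + |b| ^ p - 2 * |(a + b) / 2| ^ p := by
  rcases eq_or_ne a b with rfl | h
  · have : (a + a) / 2 = a := by ring
    rw [this]; linarith
  · exact (phi_mid hp h).le

lemma phi_mid_unif {p : ℝ} (hp : 1 < p) (R ε : ℝ) (hε : 0 < ε) :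
    ∃ δ > 0, ∀ a b : ℝ, |a| ≤ R → |b| ≤ R → ε ≤ |a - b| →
      δ ≤ |a| ^ p + |b| ^ p - 2 * |(a + b) / 2| ^ p := by
  let S : Set (ℝ × ℝ) := (closedBall 0 R ×ˢ closedBall 0 R) ∩ {z | ε ≤ |z.1 - z.2|}
  have hS : IsCompact S := by
    refine ((isCompact_closedBall _ _).prod (isCompact_closedBall _ _)).inter_right ?_
    exact isClosed_le continuous_const (by fun_prop)
  have hmem : ∀ a b : ℝ, |a| ≤ R → |b| ≤ R → ε ≤ |a - b| → (a, b) ∈ S := by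
    intro a b ha hb hab
    refine ⟨⟨?_, ?_⟩, hab⟩ <;> simpa
  rcases S.eq_empty_or_nonempty with h | h
  · refine ⟨1, one_pos, fun a b ha hb hab => ?_⟩
    have := hmem a b ha hb hab
    rw [h] at this; exact absurd this (Set.notMem_empty _)
  · have hc : Continuous (fun z : ℝ × ℝ => |z.1| ^ p + |z.2| ^ p - 2 * |(z.1 + z.2) / 2| ^ p) := by
      have h1 : Continuous (fun z : ℝ × ℝ => |z.1| ^ p) := (phi_cont hp).comp continuous_fst
      have h2 : Continuous (fun z : ℝ × ℝ => |z.2| ^ p) := (phi_cont hp).comp continuous_snd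
      have h3 : Continuous (fun z : ℝ × ℝ => |(z.1 + z.2) / 2| ^ p) :=
        (phi_cont hp).comp (by fun_prop : Continuous (fun z : ℝ × ℝ => (z.1 + z.2) / 2))
      exact (h1.add h2).sub (continuous_const.mul h3)
    obtain ⟨z, hz, hmin⟩ := hS.exists_isMinOn h hc.continuousOn
    refine ⟨_, phi_mid hp (a := z.1) (b := z.2) ?_, fun a b ha hb hab =>
      hmin (hmem a b ha hb hab)⟩
    intro h; have := hz.2; simp [h] at this; linarith

lemma q_tendsto {p : ℝ} (hp : 1 < p) (a b : ℝ) :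
    Tendsto (fun k : ℕ => (|a + (1 / ((k : ℝ) + 1)) * b| ^ p - |a| ^ p) / (1 / ((k : ℝ) + 1)))
      atTop (𝓝 (p * (Lg p a * b))) := by
  have h1 : HasDerivAt (fun t : ℝ => a + t * b) b 0 := by
    simpa using ((hasDerivAt_id (0:ℝ)).mul_const b).const_add a
  have h2 : HasDerivAt (fun t : ℝ => |a + t * b| ^ p) (p * |a| ^ (p - 2) * a * b) 0 := by
    have := hasDerivAt_abs_rpow (a + 0 * b) hp
    have h := this.comp (0:ℝ) h1
    simp only [zero_mul, add_zero] at h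
    exact h
  have h3 := (hasDerivAt_iff_tendsto_slope_zero.mp h2)
  have h4 : Tendsto (fun k : ℕ => 1 / ((k : ℝ) + 1)) atTop (𝓝[≠] 0) := by
    refine tendsto_nhdsWithin_iff.mpr ⟨tendsto_one_div_add_atTop_nhds_zero_nat, ?_⟩
    filter_upwards with k
    have : (0:ℝ) < 1 / ((k : ℝ) + 1) := by positivity
    exact this.ne'
  have h5 := h3.comp h4
  have e : p * |a| ^ (p - 2) * a * b = p * (Lg p a * b) := by unfold Lg; ring
  rw [e] at h5
  refine h5.congr (fun k => ?_)
  simp [div_eq_inv_mul]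

lemma q_le {p : ℝ} (hp : 1 < p) (a b t : ℝ) (h0 : 0 < t) (h1 : t ≤ 1) :
    (|a + t * b| ^ p - |a| ^ p) / t ≤ |a + b| ^ p - |a| ^ p := by
  rw [div_le_iff₀ h0]
  linarith [phi_convex hp a b t h0.le h1]

lemma subgrad {p : ℝ} (hp : 1 < p) (a b : ℝ) :
    p * (Lg p a * b) ≤ |a + b| ^ p - |a| ^ p := by
  refine le_of_tendsto' (q_tendsto hp a b) (fun k => ?_)
  refine q_le hp a b _ (by positivity) ?_
  rw [div_le_one (by positivity)]; linarith [(Nat.cast_nonneg k : (0:ℝ) ≤ k)]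

lemma le_q {p : ℝ} (hp : 1 < p) (a b t : ℝ) (h0 : 0 < t) :
    p * (Lg p a * b) ≤ (|a + t * b| ^ p - |a| ^ p) / t := by
  rw [le_div_iff₀ h0]
  linarith [subgrad hp a (t * b)]

lemma phi_diff {p : ℝ} (hp : 1 < p) (a b : ℝ) :
    |(|b| ^ p - |a| ^ p)| ≤ p * (|a| ^ (p - 1) * |b - a|) + p * (|b| ^ (p - 1) * |b - a|) := by
  have h1 := subgrad hp a (b - a)
  have h2 := subgrad hp b (a - b)
  have e1 : a + (b - a) = b := by ring
  have e2 : b + (a - b) = a := by ring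
  rw [e1] at h1; rw [e2] at h2
  have h3 : |Lg p a * (b - a)| = |a| ^ (p - 1) * |b - a| := by rw [abs_mul, abs_Lg hp]
  have h4 : |Lg p b * (a - b)| = |b| ^ (p - 1) * |b - a| := by
    rw [abs_mul, abs_Lg hp, abs_sub_comm]
  have h5 := neg_abs_le (Lg p a * (b - a))
  have h6 := neg_abs_le (Lg p b * (a - b))
  rw [h3] at h5; rw [h4] at h6
  have h7 : 0 ≤ |a| ^ (p - 1) * |b - a| := by positivity
  have h8 : 0 ≤ |b| ^ (p - 1) * |b - a| := by positivity
  rw [abs_le]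
  constructor <;> nlinarith

lemma add_rpow_le {q : ℝ} (hq : 0 ≤ q) (a b : ℝ) :
    |a + b| ^ q ≤ 2 ^ q * (|a| ^ q + |b| ^ q) := by
  have h1 : |a + b| ≤ 2 * max |a| |b| := by
    linarith [abs_add_le a b, le_max_left |a| |b|, le_max_right |a| |b|]
  have h2 : |a + b| ^ q ≤ (2 * max |a| |b|) ^ q := Real.rpow_le_rpow (abs_nonneg _) h1 hq
  rw [Real.mul_rpow (by norm_num) (by positivity)] at h2
  refine h2.trans ?_
  gcongr
  have ha : 0 ≤ |a| ^ q := by positivity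
  have hb : 0 ≤ |b| ^ q := by positivity
  rcases max_choice |a| |b| with h | h <;> rw [h] <;> linarith

lemma sub_rpow_le {q : ℝ} (hq : 0 ≤ q) (a b : ℝ) :
    |a - b| ^ q ≤ 2 ^ q * (|a| ^ q + |b| ^ q) := by
  have := add_rpow_le hq a (-b)
  rwa [abs_neg, ← sub_eq_add_neg] at this

lemma rpow_split {p a : ℝ} (hp : 1 < p) (ha : 0 ≤ a) : a ^ p = a ^ (p - 1) * a := by
  rcases ha.eq_or_lt with rfl | h
  · simp [Real.zero_rpow (by linarith : p ≠ 0)]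
  · rw [← Real.rpow_add_one h.ne']; congr 1; ring

lemma young {p : ℝ} (hp : 1 < p) (η : ℝ) (hη : 0 < η) :
    ∃ C : ℝ, 0 ≤ C ∧ ∀ a b : ℝ, 0 ≤ a → 0 ≤ b → a ^ (p - 1) * b ≤ η * b ^ p + C * a ^ p := by
  have hp1 : 0 < p - 1 := by linarith
  refine ⟨η ^ (-(1 / (p - 1))), by positivity, fun a b ha hb => ?_⟩
  set N := η ^ (-(1 / (p - 1))) with hN
  have hNpos : 0 < N := by positivity
  have hNp : N ^ (p - 1) = η⁻¹ := by
    rw [hN, ← Real.rpow_mul hη.le]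
    have : -(1 / (p - 1)) * (p - 1) = -1 := by field_simp
    rw [this, Real.rpow_neg_one]
  rw [rpow_split hp ha, rpow_split hp hb]
  have hA : 0 ≤ a ^ (p - 1) := by positivity
  have hB : 0 ≤ b ^ (p - 1) := by positivity
  rcases le_total b (N * a) with h | h
  · have h1 : a ^ (p - 1) * b ≤ a ^ (p - 1) * (N * a) := by gcongr
    have h2 : 0 ≤ η * (b ^ (p - 1) * b) := by positivity
    linarith
  · have h1 : (N * a) ^ (p - 1) ≤ b ^ (p - 1) := Real.rpow_le_rpow (by positivity) h hp1.le
    rw [Real.mul_rpow hNpos.le ha, hNp, inv_mul_le_iff₀ hη] at h1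
    have h2 : a ^ (p - 1) * b ≤ η * b ^ (p - 1) * b := by gcongr
    have h3 : 0 ≤ N * (a ^ (p - 1) * a) := by positivity
    linarith

lemma young1 {p : ℝ} (hp : 1 < p) (a b : ℝ) (ha : 0 ≤ a) (hb : 0 ≤ b) :
    a ^ (p - 1) * b ≤ b ^ p + a ^ p := by
  rw [rpow_split hp ha, rpow_split hp hb]
  have hA : 0 ≤ a ^ (p - 1) := by positivity
  have hB : 0 ≤ b ^ (p - 1) := by positivity
  rcases le_total b a with h | h
  · have h1 : a ^ (p - 1) * b ≤ a ^ (p - 1) * a := by gcongr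
    have h2 : 0 ≤ b ^ (p - 1) * b := by positivity
    linarith
  · have h1 : a ^ (p - 1) ≤ b ^ (p - 1) := Real.rpow_le_rpow (by positivity) h (by linarith)
    have h2 : a ^ (p - 1) * b ≤ b ^ (p - 1) * b := by gcongr
    have h3 : 0 ≤ a ^ (p - 1) * a := by positivity
    linarith

lemma phi_coer {p : ℝ} (hp : 1 < p) (α β : ℝ) :
    (2 ^ p)⁻¹ * |α| ^ p - (p + 2) * (|β| ^ (p - 1) * |α|) ≤ |β + α| ^ p - |β| ^ p := by
  have hα := rpow_split hp (abs_nonneg α)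
  have hβ := rpow_split hp (abs_nonneg β)
  have hA : 0 ≤ |α| ^ (p - 1) := by positivity
  have hB : 0 ≤ |β| ^ (p - 1) := by positivity
  have h2 : (1:ℝ) ≤ 2 ^ p := Real.one_le_rpow (by norm_num) (by linarith)
  have hX : 0 ≤ |β| ^ (p - 1) * |α| := by positivity
  rcases le_total |β| |α| with h | h
  · have h1 := sub_rpow_le (by linarith : 0 ≤ p) (β + α) β
    have e : β + α - β = α := by ring
    rw [e, ← inv_mul_le_iff₀ (by positivity)] at h1
    have h3 : |β| ^ p ≤ |β| ^ (p - 1) * |α| := by rw [hβ]; gcongr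
    nlinarith
  · have h1 := subgrad hp β α
    have h3 : |α| ^ p ≤ |β| ^ (p - 1) * |α| := by
      rw [hα]; gcongr
    have h4 : (2 ^ p)⁻¹ * |α| ^ p ≤ |α| ^ p := by
      have : ((2:ℝ) ^ p)⁻¹ ≤ 1 := inv_le_one_of_one_le₀ h2
      have h5 : 0 ≤ |α| ^ p := by positivity
      nlinarith
    have h5 := neg_abs_le (Lg p β * α)
    rw [abs_mul, abs_Lg hp] at h5
    nlinarith

/-- Lower bound on the far region. -/
lemma far_lower {p : ℝ} (hp : 1 < p) (η : ℝ) (hη : 0 < η) :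
    ∃ C : ℝ, 0 ≤ C ∧ ∀ a a₀ b : ℝ,
      (2 ^ p)⁻¹ * |a - a₀| ^ p ≤ (|a - b| ^ p - |a₀ - b| ^ p) +
        (η * ((1 + |b| ^ (p - 1)) * |a - a₀| ^ p) + C * (|a₀| ^ p + |b| ^ (p - 1))) := by
  have hM : 0 < (p + 2) * 2 ^ (p - 1) := by positivity
  set M := (p + 2) * 2 ^ (p - 1) with hMdef
  obtain ⟨C, hC, hY⟩ := young hp (η / M) (by positivity)
  refine ⟨M * C, by positivity, fun a a₀ b => ?_⟩
  have h1 := phi_coer hp (a - a₀) (a₀ - b)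
  have e : a₀ - b + (a - a₀) = a - b := by ring
  rw [e] at h1
  have h2 := sub_rpow_le (by linarith : 0 ≤ p - 1) a₀ b
  have hw : 0 ≤ |a - a₀| := abs_nonneg _
  have h3 := hY |a₀| |a - a₀| (abs_nonneg _) hw
  have h4 := hY 1 |a - a₀| zero_le_one hw
  simp only [Real.one_rpow, one_mul, mul_one] at h4
  have hb : 0 ≤ |b| ^ (p - 1) := by positivity
  have h5 : (p + 2) * (|a₀ - b| ^ (p - 1) * |a - a₀|) ≤
      M * (|a₀| ^ (p - 1) * |a - a₀|) + M * (|b| ^ (p - 1) * |a - a₀|) := by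
    calc (p + 2) * (|a₀ - b| ^ (p - 1) * |a - a₀|) ≤
        (p + 2) * ((2 ^ (p - 1) * (|a₀| ^ (p - 1) + |b| ^ (p - 1))) * |a - a₀|) := by gcongr
      _ = _ := by rw [hMdef]; ring
  have h6 : M * (|a₀| ^ (p - 1) * |a - a₀|) ≤ η * |a - a₀| ^ p + M * C * |a₀| ^ p := by
    calc _ ≤ M * (η / M * |a - a₀| ^ p + C * |a₀| ^ p) := by gcongr
      _ = _ := by field_simp
  have h7 : M * (|b| ^ (p - 1) * |a - a₀|) ≤
      η * |b| ^ (p - 1) * |a - a₀| ^ p + M * C * |b| ^ (p - 1) := by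
    calc _ ≤ M * (|b| ^ (p - 1) * (η / M * |a - a₀| ^ p + C)) := by gcongr
      _ = _ := by field_simp
  linarith

end Obst

namespace Obst

lemma fatou_real {Z : Type*} [MeasurableSpace Z] {m : Measure Z} {f : ℕ → Z → ℝ} {F : Z → ℝ}
    (hi : ∀ j, Integrable (f j) m) (h0 : ∀ j, ∀ᵐ z ∂m, 0 ≤ f j z)
    (hlim : ∀ᵐ z ∂m, Tendsto (fun j => f j z) atTop (𝓝 (F z)))
    {b : ℕ → ℝ} {B : ℝ} (hb : ∀ j, ∫ z, f j z ∂m ≤ b j) (hB : Tendsto b atTop (𝓝 B)) :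
    Integrable F m ∧ ∫ z, F z ∂m ≤ B := by
  have hFm : AEStronglyMeasurable F m :=
    aestronglyMeasurable_of_tendsto_ae atTop (fun j => (hi j).1) hlim
  have hF0 : ∀ᵐ z ∂m, 0 ≤ F z := by
    filter_upwards [hlim, ae_all_iff.mpr h0] with z h1 h2
    exact ge_of_tendsto' h1 h2
  have hB0 : 0 ≤ B := ge_of_tendsto' hB (fun j => (integral_nonneg_of_ae (h0 j)).trans (hb j))
  have key : ∫⁻ z, ENNReal.ofReal (F z) ∂m ≤ ENNReal.ofReal B := by
    calc ∫⁻ z, ENNReal.ofReal (F z) ∂m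
        = ∫⁻ z, liminf (fun j => ENNReal.ofReal (f j z)) atTop ∂m := by
          refine lintegral_congr_ae ?_
          filter_upwards [hlim] with z hz
          exact ((ENNReal.tendsto_ofReal hz).liminf_eq).symm
      _ ≤ liminf (fun j => ∫⁻ z, ENNReal.ofReal (f j z) ∂m) atTop :=
          lintegral_liminf_le' (fun j => (hi j).1.aemeasurable.ennreal_ofReal)
      _ ≤ liminf (fun j => ENNReal.ofReal (b j)) atTop := by
          refine liminf_le_liminf (Eventually.of_forall fun j => ?_)
          rw [← ofReal_integral_eq_lintegral_ofReal (hi j) (h0 j)]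
          exact ENNReal.ofReal_le_ofReal (hb j)
      _ = ENNReal.ofReal B := (ENNReal.tendsto_ofReal hB).liminf_eq
  have hFi : Integrable F m := by
    refine ⟨hFm, ?_⟩
    rw [hasFiniteIntegral_iff_ofReal hF0]
    exact key.trans_lt ENNReal.ofReal_lt_top
  refine ⟨hFi, ?_⟩
  rw [← ofReal_integral_eq_lintegral_ofReal hFi hF0] at key
  exact (ENNReal.ofReal_le_ofReal_iff hB0).mp key

lemma cauchy_in_measure {X : Type*} [MeasurableSpace X] {μ : Measure X} {u : ℕ → X → ℝ}
    (hu : ∀ j, AEMeasurable (u j) μ)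
    (hC : ∀ ε : ℝ, 0 < ε → ∀ η : ℝ, 0 < η → ∃ N : ℕ, ∀ j ≥ N, ∀ k ≥ N,
      μ {x | ε ≤ |u j x - u k x|} ≤ ENNReal.ofReal η) :
    ∃ ns : ℕ → ℕ, StrictMono ns ∧ ∃ F : X → ℝ, Measurable F ∧
      ∀ᵐ x ∂μ, Tendsto (fun i => u (ns i) x) atTop (𝓝 (F x)) := by
  have hpow : ∀ i : ℕ, (0:ℝ) < (1/2)^i := fun i => by positivity
  choose N hN using fun i : ℕ => hC ((1/2)^i) (hpow i) ((1/2)^i) (hpow i)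
  -- strictly increasing choice
  let ns : ℕ → ℕ := fun i => Nat.rec (N 0) (fun i r => max (r + 1) (N (i + 1))) i
  have hns_succ : ∀ i, ns (i + 1) = max (ns i + 1) (N (i + 1)) := fun i => rfl
  have hmono : StrictMono ns := strictMono_nat_of_lt_succ (fun i => by
    rw [hns_succ]; exact lt_of_lt_of_le (Nat.lt_succ_self _) (le_max_left _ _))
  have hge : ∀ i, N i ≤ ns i := by
    intro i
    cases i with
    | zero => exact le_rfl
    | succ i => rw [hns_succ]; exact le_max_right _ _
  let S : ℕ → Set X := fun i => {x | (1/2:ℝ)^i ≤ |u (ns i) x - u (ns (i+1)) x|}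
  have hS : ∀ i, μ (S i) ≤ ENNReal.ofReal ((1/2)^i) := fun i =>
    hN i _ (hge i) _ ((hge i).trans (hmono (Nat.lt_succ_self i)).le)
  have hsum : ∑' i, μ (S i) ≠ ∞ := by
    refine ne_top_of_le_ne_top ?_ (ENNReal.tsum_le_tsum hS)
    rw [← ENNReal.ofReal_tsum_of_nonneg (fun i => (hpow i).le) summable_geometric_two]
    exact ENNReal.ofReal_ne_top
  have hae : ∀ᵐ x ∂μ, ∃ l : ℝ, Tendsto (fun i => u (ns i) x) atTop (𝓝 l) := by
    filter_upwards [ae_eventually_notMem hsum] with x hx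
    obtain ⟨M, hM⟩ := eventually_atTop.mp hx
    have hc : CauchySeq (fun i => u (ns (i + M)) x) := by
      refine cauchySeq_of_le_geometric (1/2) ((1/2)^M) (by norm_num) (fun i => ?_)
      have := hM (i + M) (Nat.le_add_left _ _)
      simp only [S, Set.mem_ofPred_eq, not_le] at this
      rw [Real.dist_eq]
      have e : i + 1 + M = i + M + 1 := by ring
      rw [e]
      calc _ ≤ (1/2:ℝ)^(i + M) := this.le
        _ = _ := by rw [pow_add]; ring
    obtain ⟨l, hl⟩ := cauchySeq_tendsto_of_complete hc
    exact ⟨l, (tendsto_add_atTop_iff_nat (f := fun i => u (ns i) x) M).mp hl⟩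
  obtain ⟨F, hFm, hF⟩ := measurable_limit_of_tendsto_metrizable_ae (fun i => hu (ns i)) hae
  exact ⟨ns, hmono, F, hFm, hF⟩

section var
variable {Z : Type*} [MeasurableSpace Z] {m : Measure Z} {p : ℝ}

lemma phi_diff_int (hp : 1 < p) {a b : Z → ℝ} (ha : AEMeasurable a m) (hb : AEMeasurable b m)
    (h1 : Integrable (fun z => |a z| ^ (p - 1) * |b z - a z|) m)
    (h2 : Integrable (fun z => |b z| ^ (p - 1) * |b z - a z|) m) :
    Integrable (fun z => |b z| ^ p - |a z| ^ p) m := by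
  refine ((h1.const_mul p).add (h2.const_mul p)).mono' ?_ ?_
  · exact (((phi_cont hp).measurable.comp_aemeasurable hb).sub
      ((phi_cont hp).measurable.comp_aemeasurable ha)).aestronglyMeasurable
  · filter_upwards with z
    exact phi_diff hp (a z) (b z)

lemma Lg_int (hp : 1 < p) {a b : Z → ℝ} (ha : AEMeasurable a m) (hb : AEMeasurable b m)
    (h1 : Integrable (fun z => |a z| ^ (p - 1) * |b z|) m) :
    Integrable (fun z => Lg p (a z) * b z) m := by
  refine h1.mono' ?_ ?_
  · exact (((Lg_meas p).comp_aemeasurable ha).mul hb).aestronglyMeasurable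
  · filter_upwards with z
    rw [Real.norm_eq_abs, abs_mul, abs_Lg hp]

lemma deriv_ineq (hp : 1 < p) {a b : Z → ℝ} (ha : AEMeasurable a m) (hb : AEMeasurable b m)
    (h1 : Integrable (fun z => |a z| ^ (p - 1) * |b z|) m)
    (h2 : Integrable (fun z => |a z + b z| ^ p - |a z| ^ p) m)
    (hmin : ∀ t : ℝ, 0 < t → t ≤ 1 → 0 ≤ ∫ z, (|a z + t * b z| ^ p - |a z| ^ p) ∂m) :
    0 ≤ ∫ z, Lg p (a z) * b z ∂m := by
  have hL := Lg_int hp ha hb h1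
  have hk : ∀ k : ℕ, (0:ℝ) < 1 / ((k:ℝ) + 1) ∧ 1 / ((k:ℝ) + 1) ≤ 1 := fun k => by
    refine ⟨by positivity, ?_⟩
    rw [div_le_one (by positivity)]; linarith [(Nat.cast_nonneg k : (0:ℝ) ≤ k)]
  have key : Tendsto (fun k : ℕ => ∫ z, (|a z + (1 / ((k : ℝ) + 1)) * b z| ^ p - |a z| ^ p) /
      (1 / ((k : ℝ) + 1)) ∂m) atTop (𝓝 (∫ z, p * (Lg p (a z) * b z) ∂m)) := by
    refine tendsto_integral_of_dominated_convergence
      (fun z => |p * (Lg p (a z) * b z)| + |(|a z + b z| ^ p - |a z| ^ p)|) ?_ ?_ ?_ ?_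
    · intro k
      refine AEMeasurable.aestronglyMeasurable ?_
      exact (((phi_cont hp).measurable.comp_aemeasurable (ha.add (hb.const_mul _))).sub
        ((phi_cont hp).measurable.comp_aemeasurable ha)).div_const _
    · exact (hL.const_mul p).abs.add h2.abs
    · intro k
      filter_upwards with z
      have q1 := le_q hp (a z) (b z) _ (hk k).1
      have q2 := q_le hp (a z) (b z) _ (hk k).1 (hk k).2
      rw [Real.norm_eq_abs, abs_le]
      have i1 := neg_abs_le (p * (Lg p (a z) * b z))
      have i2 := le_abs_self (|a z + b z| ^ p - |a z| ^ p)
      have i3 := abs_nonneg (p * (Lg p (a z) * b z))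
      have i4 := abs_nonneg (|a z + b z| ^ p - |a z| ^ p)
      constructor <;> linarith
    · filter_upwards with z
      exact q_tendsto hp (a z) (b z)
  have h0 : 0 ≤ ∫ z, p * (Lg p (a z) * b z) ∂m := by
    refine ge_of_tendsto' key (fun k => ?_)
    rw [integral_div]
    exact div_nonneg (hmin _ (hk k).1 (hk k).2) (hk k).1.le
  rw [integral_const_mul] at h0
  exact nonneg_of_mul_nonneg_right h0 (by linarith)

end var
end Obst

namespace Obst

/-- The abstract setting. -/
structure Dat {X : Type*} [MeasurableSpace X] (μ ν : Measure X) (m1 m2 : Measure (X × X))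
    (Ω : Set X) (g : X → ℝ) (p : ℝ) (c1 C1 : NNReal) : Prop where
  hp : 1 < p
  hΩ : MeasurableSet Ω
  hfin : μ Ω < ∞
  sfin : SigmaFinite μ
  νfin : IsFiniteMeasure ν
  ν0 : ν ≠ 0
  hac1 : m1 ≪ μ.prod μ
  hac2 : m2 ≪ μ.prod μ
  hc1 : 0 < c1
  hlow : c1 • ((μ.restrict Ω).prod ν) ≤ m2
  hup : m2 ≤ C1 • ((μ.restrict Ω).prod ν)
  hνΩ : ∀ᵐ y ∂ν, y ∉ Ω
  hg : AEMeasurable g μ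
  hgi : Integrable (fun y => |g y| ^ (p - 1)) ν

/-- Admissible functions in the abstract setting. -/
def Adm {X : Type*} [MeasurableSpace X] (μ : Measure X) (m1 : Measure (X × X))
    (Ω : Set X) (g : X → ℝ) (h : X → EReal) (p : ℝ) : Set (X → ℝ) :=
  {u | AEMeasurable u μ ∧ IntegrableOn (fun x => |u x| ^ p) Ω μ ∧
    Integrable (fun z : X × X => |u z.1 - u z.2| ^ p) m1 ∧
    (∀ᵐ x ∂μ, x ∈ Ω → h x ≤ (u x : EReal)) ∧ (∀ᵐ x ∂μ, x ∉ Ω → u x = g x)}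

/-- Finite difference. -/
def dd {X : Type*} (u : X → ℝ) (z : X × X) : ℝ := u z.1 - u z.2

section core
variable {X : Type*} [MeasurableSpace X] {μ ν : Measure X} {m1 m2 : Measure (X × X)}
    {Ω : Set X} {g : X → ℝ} {h : X → EReal} {p : ℝ} {c1 C1 : NNReal}

lemma ae_fst [SigmaFinite μ] {m : Measure (X × X)} (hm : m ≪ μ.prod μ) {P : X → Prop}
    (hP : ∀ᵐ x ∂μ, P x) : ∀ᵐ z ∂m, P z.1 :=
  hm.ae_le (Measure.quasiMeasurePreserving_fst.ae hP)

lemma ae_snd [SigmaFinite μ] {m : Measure (X × X)} (hm : m ≪ μ.prod μ) {P : X → Prop}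
    (hP : ∀ᵐ x ∂μ, P x) : ∀ᵐ z ∂m, P z.2 :=
  hm.ae_le (Measure.quasiMeasurePreserving_snd.ae hP)

lemma dd_meas [SigmaFinite μ] {m : Measure (X × X)} (hm : m ≪ μ.prod μ) {u : X → ℝ}
    (hu : AEMeasurable u μ) : AEMeasurable (dd u) m := by
  have h1 : AEMeasurable (fun z : X × X => u z.1) (μ.prod μ) :=
    hu.comp_quasiMeasurePreserving Measure.quasiMeasurePreserving_fst
  have h2 : AEMeasurable (fun z : X × X => u z.2) (μ.prod μ) :=
    hu.comp_quasiMeasurePreserving Measure.quasiMeasurePreserving_snd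
  exact (h1.sub h2).mono_ac hm

namespace Dat

lemma rho_ac (D : Dat μ ν m1 m2 Ω g p c1 C1) : m2 ≪ (μ.restrict Ω).prod ν := by
  have := D.hup
  exact Measure.absolutelyContinuous_of_le_smul (c := (C1 : ℝ≥0∞)) this

lemma far (D : Dat μ ν m1 m2 Ω g p c1 C1) : ∀ᵐ z ∂m2, z.2 ∉ Ω :=
  D.rho_ac.ae_le (Measure.quasiMeasurePreserving_snd.ae D.hνΩ)

lemma near (D : Dat μ ν m1 m2 Ω g p c1 C1) : ∀ᵐ z ∂m2, z.1 ∈ Ω :=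
  D.rho_ac.ae_le (Measure.quasiMeasurePreserving_fst.ae (ae_restrict_mem D.hΩ))

lemma farg (D : Dat μ ν m1 m2 Ω g p c1 C1) {u : X → ℝ} (hu : u ∈ Adm μ m1 Ω g h p) : ∀ᵐ z ∂m2, u z.2 = g z.2 := by
  have := D.sfin
  filter_upwards [D.far, ae_snd D.hac2 hu.2.2.2.2] with z h1 h2 using h2 h1

lemma mulInt (D : Dat μ ν m1 m2 Ω g p c1 C1) {F G : X → ℝ} (hF : IntegrableOn F Ω μ) (hG : Integrable G ν) :
    Integrable (fun z : X × X => F z.1 * G z.2) m2 :=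
  ((hF.mul_prod hG).smul_measure_nnreal).mono_measure D.hup

lemma fstInt (D : Dat μ ν m1 m2 Ω g p c1 C1) {F : X → ℝ} (hF : IntegrableOn F Ω μ) :
    Integrable (fun z : X × X => F z.1) m2 := by
  have := D.νfin
  simpa using D.mulInt hF (integrable_const (1:ℝ))

lemma sndInt (D : Dat μ ν m1 m2 Ω g p c1 C1) {G : X → ℝ} (hG : Integrable G ν) :
    Integrable (fun z : X × X => G z.2) m2 := by
  have : IntegrableOn (fun _ : X => (1:ℝ)) Ω μ :=
    integrableOn_const D.hfin.ne
  simpa using D.mulInt this hG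

lemma int_up (D : Dat μ ν m1 m2 Ω g p c1 C1) {F G : X → ℝ} (hF : IntegrableOn F Ω μ) (hG : Integrable G ν)
    (hF0 : ∀ x, 0 ≤ F x) (hG0 : ∀ x, 0 ≤ G x) :
    ∫ z, F z.1 * G z.2 ∂m2 ≤ C1 * ((∫ x in Ω, F x ∂μ) * ∫ y, G y ∂ν) := by
  have := D.νfin
  have := D.sfin
  rw [← integral_prod_mul, ← smul_eq_mul, ← NNReal.smul_def, ← integral_smul_nnreal_measure]
  refine integral_mono_measure D.hup ?_ (hF.mul_prod hG).smul_measure_nnreal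
  filter_upwards with z using mul_nonneg (hF0 _) (hG0 _)

lemma int_low (D : Dat μ ν m1 m2 Ω g p c1 C1) {F G : X → ℝ} (hF : IntegrableOn F Ω μ) (hG : Integrable G ν)
    (hF0 : ∀ x, 0 ≤ F x) (hG0 : ∀ x, 0 ≤ G x) :
    c1 * ((∫ x in Ω, F x ∂μ) * ∫ y, G y ∂ν) ≤ ∫ z, F z.1 * G z.2 ∂m2 := by
  have := D.νfin
  have := D.sfin
  rw [← integral_prod_mul, ← smul_eq_mul, ← NNReal.smul_def, ← integral_smul_nnreal_measure]
  refine integral_mono_measure D.hlow ?_ (D.mulInt hF hG)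
  filter_upwards with z using mul_nonneg (hF0 _) (hG0 _)

end Dat

lemma phi_sub_int {Z : Type*} [MeasurableSpace Z] {m : Measure Z} (hp : 1 < p) {u v : Z → ℝ}
    (hu : AEMeasurable u m) (hv : AEMeasurable v m)
    (hu1 : Integrable (fun x => |u x| ^ p) m) (hv1 : Integrable (fun x => |v x| ^ p) m) :
    Integrable (fun x => |u x - v x| ^ p) m := by
  refine ((hu1.add hv1).const_mul (2 ^ p)).mono' ?_ ?_
  · exact ((phi_cont hp).measurable.comp_aemeasurable (hu.sub hv)).aestronglyMeasurable
  · filter_upwards with x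
    rw [Real.norm_eq_abs, abs_of_nonneg (by positivity)]
    exact sub_rpow_le (by linarith) _ _

namespace Dat

lemma int1 (D : Dat μ ν m1 m2 Ω g p c1 C1) {u v w : X → ℝ} (hu : u ∈ Adm μ m1 Ω g h p) (hv : v ∈ Adm μ m1 Ω g h p)
    (hw : w ∈ Adm μ m1 Ω g h p) :
    Integrable (fun z => |dd u z| ^ (p - 1) * |dd v z - dd w z|) m1 := by
  have := D.sfin
  have mu := dd_meas D.hac1 hu.1
  have mv := dd_meas D.hac1 hv.1
  have mw := dd_meas D.hac1 hw.1
  refine ((phi_sub_int D.hp mv mw hv.2.2.1 hw.2.2.1).add hu.2.2.1).mono' ?_ ?_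
  · exact (((phi1_cont D.hp).measurable.comp_aemeasurable mu).mul
      (continuous_abs.measurable.comp_aemeasurable (mv.sub mw))).aestronglyMeasurable
  · filter_upwards with z
    rw [Real.norm_eq_abs, abs_of_nonneg (by positivity)]
    exact young1 D.hp _ _ (abs_nonneg _) (abs_nonneg _)

lemma diffInt (D : Dat μ ν m1 m2 Ω g p c1 C1) {v w : X → ℝ} (hv : v ∈ Adm μ m1 Ω g h p) (hw : w ∈ Adm μ m1 Ω g h p) :
    IntegrableOn (fun x => |v x - w x| ^ p) Ω μ :=
  Obst.phi_sub_int D.hp hv.1.restrict hw.1.restrict hv.2.1 hw.2.1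

lemma int2 (D : Dat μ ν m1 m2 Ω g p c1 C1) {u v w : X → ℝ} (hu : u ∈ Adm μ m1 Ω g h p) (hv : v ∈ Adm μ m1 Ω g h p)
    (hw : w ∈ Adm μ m1 Ω g h p) :
    Integrable (fun z => |dd u z| ^ (p - 1) * |dd v z - dd w z|) m2 := by
  have := D.sfin
  have := D.νfin
  have hp := D.hp
  have mu := dd_meas D.hac2 hu.1
  have mv := dd_meas D.hac2 hv.1
  have mw := dd_meas D.hac2 hw.1
  have i1 := D.diffInt hv hw
  have I1 := D.fstInt i1
  have I2 := D.fstInt hu.2.1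
  have I3 := D.mulInt i1 D.hgi
  have I4 := D.sndInt D.hgi
  refine (((I1.add I2).add (I3.add I4)).const_mul (2 ^ (p - 1))).mono' ?_ ?_
  · exact (((phi1_cont D.hp).measurable.comp_aemeasurable mu).mul
      (continuous_abs.measurable.comp_aemeasurable (mv.sub mw))).aestronglyMeasurable
  · filter_upwards [D.farg hu, D.farg hv, D.farg hw] with z h1 h2 h3
    rw [Real.norm_eq_abs, abs_of_nonneg (by positivity)]
    simp only [dd, h1, h2, h3, Pi.add_apply]
    have e : v z.1 - g z.2 - (w z.1 - g z.2) = v z.1 - w z.1 := by ring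
    rw [e]
    have j1 := sub_rpow_le (by linarith : 0 ≤ p - 1) (u z.1) (g z.2)
    have j2 := young1 hp _ _ (abs_nonneg (u z.1)) (abs_nonneg (v z.1 - w z.1))
    have j3 := young1 hp 1 _ zero_le_one (abs_nonneg (v z.1 - w z.1))
    simp only [Real.one_rpow, one_mul] at j3
    have hG : 0 ≤ |g z.2| ^ (p - 1) := by positivity
    calc |u z.1 - g z.2| ^ (p - 1) * |v z.1 - w z.1|
        ≤ (2 ^ (p - 1) * (|u z.1| ^ (p - 1) + |g z.2| ^ (p - 1))) * |v z.1 - w z.1| := by gcongr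
      _ = 2 ^ (p - 1) * (|u z.1| ^ (p - 1) * |v z.1 - w z.1| +
          |g z.2| ^ (p - 1) * |v z.1 - w z.1|) := by ring
      _ ≤ 2 ^ (p - 1) * ((|v z.1 - w z.1| ^ p + |u z.1| ^ p) +
          |g z.2| ^ (p - 1) * (|v z.1 - w z.1| ^ p + 1)) := by gcongr
      _ = _ := by ring

end Dat

/-- The combined measure. -/
noncomputable def mm (m1 m2 : Measure (X × X)) : Measure (X × X) := m1 + (m2 + m2)

namespace Dat

lemma mm_ac (D : Dat μ ν m1 m2 Ω g p c1 C1) : mm m1 m2 ≪ μ.prod μ :=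
  Measure.AbsolutelyContinuous.add_left D.hac1 (Measure.AbsolutelyContinuous.add_left D.hac2 D.hac2)

lemma intm (D : Dat μ ν m1 m2 Ω g p c1 C1) {u v w : X → ℝ} (hu : u ∈ Adm μ m1 Ω g h p) (hv : v ∈ Adm μ m1 Ω g h p)
    (hw : w ∈ Adm μ m1 Ω g h p) :
    Integrable (fun z => |dd u z| ^ (p - 1) * |dd v z - dd w z|) (mm m1 m2) :=
  (D.int1 hu hv hw).add_measure ((D.int2 hu hv hw).add_measure (D.int2 hu hv hw))

lemma phiInt (D : Dat μ ν m1 m2 Ω g p c1 C1) {u v : X → ℝ} (hu : u ∈ Adm μ m1 Ω g h p) (hv : v ∈ Adm μ m1 Ω g h p) :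
    Integrable (fun z => |dd v z| ^ p - |dd u z| ^ p) (mm m1 m2) := by
  have := D.sfin
  exact phi_diff_int D.hp (dd_meas D.mm_ac hu.1) (dd_meas D.mm_ac hv.1)
    (D.intm hu hv hu) (D.intm hv hv hu)

lemma phiInt2 (D : Dat μ ν m1 m2 Ω g p c1 C1) {u v : X → ℝ} (hu : u ∈ Adm μ m1 Ω g h p) (hv : v ∈ Adm μ m1 Ω g h p) :
    Integrable (fun z => |dd v z| ^ p - |dd u z| ^ p) m2 :=
  (D.phiInt hu hv).right_of_add_measure.right_of_add_measure

lemma convex (D : Dat μ ν m1 m2 Ω g p c1 C1) {u v : X → ℝ} (hu : u ∈ Adm μ m1 Ω g h p) (hv : v ∈ Adm μ m1 Ω g h p)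
    (t : ℝ) (h0 : 0 ≤ t) (h1 : t ≤ 1) :
    (fun x => u x + t * (v x - u x)) ∈ Adm μ m1 Ω g h p := by
  have := D.sfin
  have hp := D.hp
  have hm : AEMeasurable (fun x => u x + t * (v x - u x)) μ := hu.1.add ((hv.1.sub hu.1).const_mul t)
  refine ⟨hm, ?_, ?_, ?_, ?_⟩
  · refine ((hu.2.1.const_mul (1 - t)).add (hv.2.1.const_mul t)).mono' ?_ ?_
    · exact ((phi_cont hp).measurable.comp_aemeasurable hm.restrict).aestronglyMeasurable
    · filter_upwards with x
      rw [Real.norm_eq_abs, abs_of_nonneg (by positivity)]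
      have := phi_convex hp (u x) (v x - u x) t h0 h1
      simpa using this
  · refine ((hu.2.2.1.const_mul (1 - t)).add (hv.2.2.1.const_mul t)).mono' ?_ ?_
    · exact ((phi_cont hp).measurable.comp_aemeasurable (dd_meas D.hac1 hm)).aestronglyMeasurable
    · filter_upwards with z
      rw [Real.norm_eq_abs, abs_of_nonneg (by positivity)]
      have := phi_convex hp (u z.1 - u z.2) (v z.1 - v z.2 - (u z.1 - u z.2)) t h0 h1
      have e : u z.1 + t * (v z.1 - u z.1) - (u z.2 + t * (v z.2 - u z.2)) =
        u z.1 - u z.2 + t * (v z.1 - v z.2 - (u z.1 - u z.2)) := by ring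
      rw [e]
      simpa using this
  · filter_upwards [hu.2.2.2.1, hv.2.2.2.1] with x h2 h3 hx
    rcases le_total (u x) (v x) with hle | hle
    · refine (h2 hx).trans (EReal.coe_le_coe_iff.mpr ?_)
      nlinarith
    · refine (h3 hx).trans (EReal.coe_le_coe_iff.mpr ?_)
      nlinarith
  · filter_upwards [hu.2.2.2.2, hv.2.2.2.2] with x h2 h3 hx
    rw [h2 hx, h3 hx]; ring

/-- Minimizers solve the variational inequality. -/
lemma min_solves (D : Dat μ ν m1 m2 Ω g p c1 C1) {u v : X → ℝ} (hu : u ∈ Adm μ m1 Ω g h p) (hv : v ∈ Adm μ m1 Ω g h p)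
    (hmin : ∀ v ∈ Adm μ m1 Ω g h p, 0 ≤ ∫ z, (|dd v z| ^ p - |dd u z| ^ p) ∂(mm m1 m2)) :
    0 ≤ ∫ z, Lg p (dd u z) * (dd v z - dd u z) ∂(mm m1 m2) := by
  have := D.sfin
  have mu := dd_meas D.mm_ac hu.1
  have mv := dd_meas D.mm_ac hv.1
  refine deriv_ineq D.hp mu (mv.sub mu) (D.intm hu hv hu) ?_ ?_
  · simpa using D.phiInt hu hv
  · intro t h0 h1
    have := hmin _ (D.convex hu hv t h0.le h1)
    have e : ∀ z, dd u z + t * (dd v z - dd u z) = dd (fun x => u x + t * (v x - u x)) z := by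
      intro z; simp only [dd]; ring
    simp only [e]
    exact this

lemma LgInt (D : Dat μ ν m1 m2 Ω g p c1 C1) {u v : X → ℝ} (hu : u ∈ Adm μ m1 Ω g h p) (hv : v ∈ Adm μ m1 Ω g h p) :
    Integrable (fun z => Lg p (dd u z) * (dd v z - dd u z)) (mm m1 m2) := by
  have := D.sfin
  have mu := dd_meas D.mm_ac hu.1
  have mv := dd_meas D.mm_ac hv.1
  exact Lg_int D.hp mu (mv.sub mu) (D.intm hu hv hu)

lemma solves_min (D : Dat μ ν m1 m2 Ω g p c1 C1) {u v : X → ℝ} (hu : u ∈ Adm μ m1 Ω g h p) (hv : v ∈ Adm μ m1 Ω g h p)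
    (hs : 0 ≤ ∫ z, Lg p (dd u z) * (dd v z - dd u z) ∂(mm m1 m2)) :
    0 ≤ ∫ z, (|dd v z| ^ p - |dd u z| ^ p) ∂(mm m1 m2) := by
  have hp := D.hp
  refine le_trans (b := ∫ z, p * (Lg p (dd u z) * (dd v z - dd u z)) ∂(mm m1 m2)) ?_ ?_
  · rw [integral_const_mul]; exact mul_nonneg (by linarith) hs
  · refine integral_mono ((D.LgInt hu hv).const_mul p) (D.phiInt hu hv) (fun z => ?_)
    have := subgrad hp (dd u z) (dd v z - dd u z)
    simpa using this

lemma mid_int (D : Dat μ ν m1 m2 Ω g p c1 C1) {u v : X → ℝ} (hu : u ∈ Adm μ m1 Ω g h p) (hv : v ∈ Adm μ m1 Ω g h p)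
    {u0 : X → ℝ} (hu0 : u0 ∈ Adm μ m1 Ω g h p) :
    ∃ w ∈ Adm μ m1 Ω g h p,
    Integrable (fun z => |dd u z| ^ p + |dd v z| ^ p - 2 * |(dd u z + dd v z) / 2| ^ p) (mm m1 m2) ∧
    ∫ z, (|dd u z| ^ p + |dd v z| ^ p - 2 * |(dd u z + dd v z) / 2| ^ p) ∂(mm m1 m2) =
      ∫ z, (|dd u z| ^ p - |dd u0 z| ^ p) ∂(mm m1 m2) +
      ∫ z, (|dd v z| ^ p - |dd u0 z| ^ p) ∂(mm m1 m2) -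
      2 * ∫ z, (|dd w z| ^ p - |dd u0 z| ^ p) ∂(mm m1 m2) := by
  have hw := D.convex hu hv (1/2) (by norm_num) (by norm_num)
  refine ⟨_, hw, ?_⟩
  have e : (fun z => |dd u z| ^ p + |dd v z| ^ p - 2 * |(dd u z + dd v z) / 2| ^ p) =
    (fun z => (|dd u z| ^ p - |dd u0 z| ^ p) + (|dd v z| ^ p - |dd u0 z| ^ p) -
      2 * (|dd (fun x => u x + 1/2 * (v x - u x)) z| ^ p - |dd u0 z| ^ p)) := by
    funext z
    have : (dd u z + dd v z) / 2 = dd (fun x => u x + 1/2 * (v x - u x)) z := by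
      simp only [dd]; ring
    rw [this]; ring
  rw [e]
  have i1 := D.phiInt hu0 hu
  have i2 := D.phiInt hu0 hv
  have i3 := D.phiInt hu0 hw
  refine ⟨(i1.add i2).sub (i3.const_mul 2), ?_⟩
  have e1 := integral_sub (i1.add i2) (i3.const_mul 2)
  have e2 := integral_add i1 i2
  simp only [Pi.add_apply] at e1
  rw [e1, e2, integral_const_mul]

lemma unique (D : Dat μ ν m1 m2 Ω g p c1 C1) {u v : X → ℝ} (hu : u ∈ Adm μ m1 Ω g h p) (hv : v ∈ Adm μ m1 Ω g h p)
    (h1 : ∀ v ∈ Adm μ m1 Ω g h p, 0 ≤ ∫ z, Lg p (dd u z) * (dd v z - dd u z) ∂(mm m1 m2))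
    (h2 : ∀ w ∈ Adm μ m1 Ω g h p, 0 ≤ ∫ z, Lg p (dd v z) * (dd w z - dd v z) ∂(mm m1 m2)) :
    ∀ᵐ x ∂μ, u x = v x := by
  have := D.sfin
  have := D.νfin
  obtain ⟨w, hw, hi, he⟩ := D.mid_int hu hv hu
  have k1 := D.solves_min hv hu (h2 u hu)
  have k2 := D.solves_min hu hw (h1 w hw)
  have k3 : ∫ z, (|dd v z| ^ p - |dd u z| ^ p) ∂(mm m1 m2) =
      - ∫ z, (|dd u z| ^ p - |dd v z| ^ p) ∂(mm m1 m2) := by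
    rw [← integral_neg]; congr 1; funext z; ring
  have hle : ∫ z, (|dd u z| ^ p + |dd v z| ^ p - 2 * |(dd u z + dd v z) / 2| ^ p) ∂(mm m1 m2) ≤ 0 := by
    rw [he]
    simp only [sub_self, integral_zero]
    linarith
  have h0 : 0 ≤ᵐ[mm m1 m2] (fun z => |dd u z| ^ p + |dd v z| ^ p - 2 * |(dd u z + dd v z) / 2| ^ p) := by
    filter_upwards with z using phi_mid_nonneg D.hp _ _
  have hz := (integral_eq_zero_iff_of_nonneg_ae h0 hi).mp (le_antisymm hle (integral_nonneg_of_ae h0))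
  have hz2 : ∀ᵐ z ∂m2, dd u z = dd v z := by
    have hle : m2 ≤ mm m1 m2 := by
      unfold mm
      exact (Measure.le_add_left le_rfl).trans (Measure.le_add_left le_rfl)
    have := (Measure.absolutelyContinuous_of_le hle).ae_le hz
    filter_upwards [this] with z hz
    by_contra hne
    exact (phi_mid D.hp hne).ne' hz
  have hz3 : ∀ᵐ z ∂m2, u z.1 = v z.1 := by
    filter_upwards [hz2, D.farg hu, D.farg hv] with z a1 a2 a3
    simp only [dd, a2, a3] at a1; linarith
  have hz4 : ∀ᵐ z ∂((μ.restrict Ω).prod ν), u z.1 = v z.1 := by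
    have hz5 := (Measure.absolutelyContinuous_of_le D.hlow).ae_le hz3
    have hc : (c1 : ℝ≥0∞) ≠ 0 := by exact_mod_cast D.hc1.ne'
    exact (Measure.absolutelyContinuous_smul hc).ae_le hz5
  have hz5 := Measure.ae_ae_of_ae_prod hz4
  have : NeBot (ae ν) := ae_neBot.mpr D.ν0
  have hz6 : ∀ᵐ x ∂μ, x ∈ Ω → u x = v x := by
    rw [← ae_restrict_iff' D.hΩ]
    filter_upwards [hz5] with x hx
    exact hx.exists.choose_spec
  filter_upwards [hz6, hu.2.2.2.2, hv.2.2.2.2] with x a1 a2 a3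
  by_cases hx : x ∈ Ω
  · exact a1 hx
  · rw [a2 hx, a3 hx]

end Dat
end core
end Obst

namespace Obst
section core2
variable {X : Type*} [MeasurableSpace X] {μ ν : Measure X} {m1 m2 : Measure (X × X)}
    {Ω : Set X} {g : X → ℝ} {h : X → EReal} {p : ℝ} {c1 C1 : NNReal}
namespace Dat

lemma J_split (D : Dat μ ν m1 m2 Ω g p c1 C1) {u u0 : X → ℝ} (hu : u ∈ Adm μ m1 Ω g h p) (hu0 : u0 ∈ Adm μ m1 Ω g h p) :
    ∫ z, (|dd u z| ^ p - |dd u0 z| ^ p) ∂(mm m1 m2) =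
      ∫ z, |dd u z| ^ p ∂m1 - ∫ z, |dd u0 z| ^ p ∂m1 +
        2 * ∫ z, (|dd u z| ^ p - |dd u0 z| ^ p) ∂m2 := by
  have i1 := (D.phiInt hu0 hu).left_of_add_measure
  have i2 := D.phiInt2 hu0 hu
  have k1 : Integrable (fun z => |dd u z| ^ p) m1 := hu.2.2.1
  have k2 : Integrable (fun z => |dd u0 z| ^ p) m1 := hu0.2.2.1
  unfold mm
  rw [integral_add_measure i1 (i2.add_measure i2), integral_add_measure i2 i2,
    integral_sub k1 k2]
  ring

lemma weightInt (D : Dat μ ν m1 m2 Ω g p c1 C1) : Integrable (fun y => 1 + |g y| ^ (p - 1)) ν := by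
  have := D.νfin
  exact (integrable_const _).add D.hgi

lemma farInt (D : Dat μ ν m1 m2 Ω g p c1 C1) {u u0 : X → ℝ} (hu : u ∈ Adm μ m1 Ω g h p) (hu0 : u0 ∈ Adm μ m1 Ω g h p) :
    Integrable (fun z : X × X => |u z.1 - u0 z.1| ^ p * (1 + |g z.2| ^ (p - 1))) m2 :=
  D.mulInt (D.diffInt hu hu0) D.weightInt

lemma errInt (D : Dat μ ν m1 m2 Ω g p c1 C1) {u0 : X → ℝ} (hu0 : u0 ∈ Adm μ m1 Ω g h p) :
    Integrable (fun z : X × X => |u0 z.1| ^ p + |g z.2| ^ (p - 1)) m2 :=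
  (D.fstInt hu0.2.1).add (D.sndInt D.hgi)

lemma coercive (D : Dat μ ν m1 m2 Ω g p c1 C1) {u0 : X → ℝ} (hu0 : u0 ∈ Adm μ m1 Ω g h p) :
    ∃ c > 0, ∃ B : ℝ, ∀ u ∈ Adm μ m1 Ω g h p,
      c * (∫ x in Ω, |u x - u0 x| ^ p ∂μ) + ∫ z, |dd u z| ^ p ∂m1 - B ≤
        ∫ z, (|dd u z| ^ p - |dd u0 z| ^ p) ∂(mm m1 m2) := by
  have := D.νfin
  have hp := D.hp
  set G : ℝ := ∫ y, (1 + |g y| ^ (p - 1)) ∂ν with hG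
  have hG0 : 0 ≤ G := integral_nonneg (fun y => by positivity)
  set N : ℝ := ∫ _y, (1:ℝ) ∂ν with hN
  have hN0 : 0 < N := by
    rw [hN]; simp only [integral_const, smul_eq_mul, mul_one]
    rw [measureReal_def]
    refine ENNReal.toReal_pos ?_ (measure_ne_top _ _)
    simpa using D.ν0
  have hc1 : (0:ℝ) < c1 := by exact_mod_cast D.hc1
  set c' : ℝ := (2 ^ p)⁻¹ * (c1 * N) with hc'
  have hc'0 : 0 < c' := by positivity
  have hC1 : (0:ℝ) ≤ C1 := C1.2
  set η : ℝ := c' / (2 * (C1 * G + 1)) with hη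
  have hη0 : 0 < η := by positivity
  obtain ⟨C, hC, hlow⟩ := far_lower hp η hη0
  set B3 := ∫ z : X × X, (|u0 z.1| ^ p + |g z.2| ^ (p - 1)) ∂m2
  refine ⟨c', hc'0, ∫ z, |dd u0 z| ^ p ∂m1 + 2 * (C * B3), fun u hu => ?_⟩
  rw [D.J_split hu hu0]
  set W := ∫ x in Ω, |u x - u0 x| ^ p ∂μ with hW
  have hW0 : 0 ≤ W := integral_nonneg (fun y => by positivity)
  have hd := D.diffInt hu hu0
  have a1 : c1 * (W * N) ≤ ∫ z : X × X, |u z.1 - u0 z.1| ^ p * 1 ∂m2 :=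
    D.int_low hd (integrable_const 1) (fun x => by positivity) (fun x => by positivity)
  have a2 : ∫ z : X × X, |u z.1 - u0 z.1| ^ p * (1 + |g z.2| ^ (p - 1)) ∂m2 ≤ C1 * (W * G) :=
    D.int_up hd D.weightInt (fun x => by positivity) (fun x => by positivity)
  simp only [mul_one] at a1
  have I1 := D.fstInt hd
  have I2 := D.phiInt2 hu0 hu
  have I3 := D.farInt hu hu0
  have I4 := D.errInt hu0
  have key : (2 ^ p)⁻¹ * ∫ z : X × X, |u z.1 - u0 z.1| ^ p ∂m2 ≤
      ∫ z, (|dd u z| ^ p - |dd u0 z| ^ p) ∂m2 +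
      (η * (∫ z : X × X, |u z.1 - u0 z.1| ^ p * (1 + |g z.2| ^ (p - 1)) ∂m2) + C * B3) := by
    have e1 := integral_add I2 ((I3.const_mul η).add (I4.const_mul C))
    have e2 := integral_add (I3.const_mul η) (I4.const_mul C)
    simp only [Pi.add_apply] at e1
    rw [← integral_const_mul, ← integral_const_mul, ← integral_const_mul, ← e2, ← e1]
    refine integral_mono_ae (I1.const_mul _) (I2.add ((I3.const_mul η).add (I4.const_mul C))) ?_
    filter_upwards [D.farg hu, D.farg hu0] with z h1 h2
    have := hlow (u z.1) (u0 z.1) (g z.2)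
    simp only [dd, h1, h2, Pi.add_apply]
    linarith
  have k1 : c' * W ≤ (2 ^ p)⁻¹ * ∫ z : X × X, |u z.1 - u0 z.1| ^ p ∂m2 := by
    calc c' * W = (2 ^ p)⁻¹ * (c1 * (W * N)) := by rw [hc']; ring
      _ ≤ _ := by gcongr
  have k2 : η * (∫ z : X × X, |u z.1 - u0 z.1| ^ p * (1 + |g z.2| ^ (p - 1)) ∂m2) ≤ c' / 2 * W := by
    calc _ ≤ η * (C1 * (W * G)) := by gcongr
      _ = (η * (C1 * G)) * W := by ring
      _ ≤ c' / 2 * W := by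
        gcongr
        rw [hη, div_mul_eq_mul_div, div_le_iff₀ (by positivity)]
        nlinarith
  linarith

lemma cauchy_step (D : Dat μ ν m1 m2 Ω g p c1 C1) {u : ℕ → X → ℝ} (hu : ∀ j, u j ∈ Adm μ m1 Ω g h p) {B : ℝ}
    (hB : ∀ j, ∫ x in Ω, |u j x| ^ p ∂μ ≤ B)
    (hD : ∀ j k, Integrable (fun z => |dd (u j) z| ^ p + |dd (u k) z| ^ p -
        2 * |(dd (u j) z + dd (u k) z) / 2| ^ p) m2)
    (hDle : ∀ j k : ℕ, ∫ z, (|dd (u j) z| ^ p + |dd (u k) z| ^ p -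
        2 * |(dd (u j) z + dd (u k) z) / 2| ^ p) ∂m2 ≤ 1 / ((j:ℝ) + 1) + 1 / ((k:ℝ) + 1)) :
    ∀ ε : ℝ, 0 < ε → ∀ η : ℝ, 0 < η → ∃ N : ℕ, ∀ j ≥ N, ∀ k ≥ N,
      (μ.restrict Ω) {x | ε ≤ |u j x - u k x|} ≤ ENNReal.ofReal η := by
  have := D.νfin
  have := D.sfin
  have hp := D.hp
  have : IsFiniteMeasure (μ.restrict Ω) := ⟨by simpa using D.hfin⟩
  have hc1 : (0:ℝ) < c1 := by exact_mod_cast D.hc1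
  intro ε hε η hη
  -- a set where g is bounded
  obtain ⟨M0, hM0⟩ : ∃ M0 : ℕ, 0 < ν {y | |g y| ≤ M0} := by
    refine exists_measure_pos_of_not_measure_iUnion_null ?_
    have : (⋃ M0 : ℕ, {y | |g y| ≤ M0}) = Set.univ := by
      ext y; simp only [Set.mem_iUnion, Set.mem_ofPred_eq, Set.mem_univ, iff_true]
      exact exists_nat_ge _
    rw [this]; simpa using D.ν0
  set Y : Set X := {y | |g y| ≤ M0} with hY
  have hYr : 0 < ν.real Y := ENNReal.toReal_pos hM0.ne' (measure_ne_top _ _)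
  have hB0 : 0 ≤ B := (integral_nonneg (fun y => by positivity)).trans (hB 0)
  set M : ℝ := 4 * (B + 1) / η + 1 with hM
  have hM1 : 1 ≤ M := by
    have : 0 ≤ 4 * (B + 1) / η := by positivity
    linarith
  obtain ⟨δ, hδ, hδD⟩ := phi_mid_unif hp (M + M0) ε hε
  -- Markov
  have hmark : ∀ j, (μ.restrict Ω).real {x | M ≤ |u j x|} ≤ η / 4 := by
    intro j
    have h1 := mul_meas_ge_le_integral_of_nonneg (μ := μ.restrict Ω) (f := fun x => |u j x| ^ p)
      (Eventually.of_forall fun x => by positivity) (hu j).2.1 (M ^ p)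
    have h2 : (μ.restrict Ω).real {x | M ≤ |u j x|} ≤
        (μ.restrict Ω).real {x | M ^ p ≤ |u j x| ^ p} := by
      refine measureReal_mono (fun x hx => ?_)
      exact Real.rpow_le_rpow (by linarith) hx (by linarith)
    have h3 : M ≤ M ^ p := by
      have := Real.rpow_le_rpow_of_exponent_le hM1 hp.le
      rwa [Real.rpow_one] at this
    set a := (μ.restrict Ω).real {x | M ≤ |u j x|}
    have ha : 0 ≤ a := measureReal_nonneg
    have h4 : M * a ≤ B := by
      calc M * a ≤ M ^ p * (μ.restrict Ω).real {x | M ^ p ≤ |u j x| ^ p} := by gcongr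
        _ ≤ _ := h1.trans (hB j)
    have h5 : 4 * (B + 1) / η * a ≤ B := by
      have : 4 * (B + 1) / η ≤ M := by rw [hM]; linarith
      nlinarith
    rw [div_mul_eq_mul_div, div_le_iff₀ hη] at h5
    by_contra hcon
    push Not at hcon
    nlinarith
  set κ : ℝ := δ * c1 * ν.real Y with hκ
  have hκ0 : 0 < κ := by positivity
  obtain ⟨N, hN⟩ := exists_nat_one_div_lt (show 0 < κ * η / 4 by positivity)
  refine ⟨N, fun j hj k hk => ?_⟩
  have hjN : 1 / ((j:ℝ) + 1) ≤ κ * η / 4 := by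
    refine le_trans ?_ hN.le
    have : (N:ℝ) ≤ j := by exact_mod_cast hj
    gcongr
  have hkN : 1 / ((k:ℝ) + 1) ≤ κ * η / 4 := by
    refine le_trans ?_ hN.le
    have : (N:ℝ) ≤ k := by exact_mod_cast hk
    gcongr
  set E : Set X := {x | |u j x| ≤ M ∧ |u k x| ≤ M ∧ ε ≤ |u j x - u k x|} with hE
  set Df : X × X → ℝ := fun z => |dd (u j) z| ^ p + |dd (u k) z| ^ p -
        2 * |(dd (u j) z + dd (u k) z) / 2| ^ p with hDf
  have hDf0 : ∀ z, 0 ≤ Df z := fun z => phi_mid_nonneg hp _ _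
  have hDi : Integrable Df (c1 • ((μ.restrict Ω).prod ν)) := (hD j k).mono_measure D.hlow
  have hDi' : Integrable Df ((μ.restrict Ω).prod ν) := by
    refine (integrable_smul_measure (c := (c1 : ℝ≥0∞)) ?_ ENNReal.coe_ne_top).mp hDi
    exact_mod_cast D.hc1.ne'
  have s1 : c1 * ∫ z, Df z ∂((μ.restrict Ω).prod ν) ≤ ∫ z, Df z ∂m2 := by
    rw [← smul_eq_mul, ← NNReal.smul_def, ← integral_smul_nnreal_measure]
    exact integral_mono_measure D.hlow (Eventually.of_forall hDf0) (hD j k)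
  have s2 := mul_meas_ge_le_integral_of_nonneg (Eventually.of_forall hDf0) hDi' δ
  have hfar : ∀ (i : ℕ), ∀ᵐ z ∂((μ.restrict Ω).prod ν), u i z.2 = g z.2 := by
    intro i
    have hz5 := (Measure.absolutelyContinuous_of_le D.hlow).ae_le (D.farg (hu i))
    have hc : (c1 : ℝ≥0∞) ≠ 0 := by exact_mod_cast D.hc1.ne'
    exact (Measure.absolutelyContinuous_smul hc).ae_le hz5
  have s3 : ((μ.restrict Ω).prod ν).real (E ×ˢ Y) ≤ ((μ.restrict Ω).prod ν).real {z | δ ≤ Df z} := by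
    refine ENNReal.toReal_mono (measure_ne_top _ _) (measure_mono_ae ?_)
    filter_upwards [hfar j, hfar k] with z f1 f2 hz
    obtain ⟨⟨hz1, hz2, hz3⟩, hz4⟩ := hz
    have hz4' : |g z.2| ≤ M0 := hz4
    refine hδD _ _ ?_ ?_ ?_
    · simp only [dd, f1]; exact (abs_sub _ _).trans (by linarith)
    · simp only [dd, f2]; exact (abs_sub _ _).trans (by linarith)
    · simp only [dd, f1, f2]; simpa using hz3
  rw [measureReal_prod_prod] at s3
  have s4 : κ * (μ.restrict Ω).real E ≤ κ * (η / 2) := by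
    calc κ * (μ.restrict Ω).real E = c1 * (δ * ((μ.restrict Ω).real E * ν.real Y)) := by
          rw [hκ]; ring
      _ ≤ c1 * (δ * ((μ.restrict Ω).prod ν).real {z | δ ≤ Df z}) := by gcongr
      _ ≤ c1 * ∫ z, Df z ∂((μ.restrict Ω).prod ν) := by gcongr
      _ ≤ _ := s1
      _ ≤ _ := hDle j k
      _ ≤ κ * η / 4 + κ * η / 4 := add_le_add hjN hkN
      _ = _ := by ring
  have s5 : (μ.restrict Ω).real E ≤ η / 2 := le_of_mul_le_mul_left s4 hκ0
  have s6 : (μ.restrict Ω).real {x | ε ≤ |u j x - u k x|} ≤ η := by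
    calc (μ.restrict Ω).real {x | ε ≤ |u j x - u k x|}
        ≤ (μ.restrict Ω).real (({x | M ≤ |u j x|} ∪ {x | M ≤ |u k x|}) ∪ E) := by
          refine measureReal_mono (fun x hx => ?_)
          by_cases q1 : M ≤ |u j x|
          · exact Or.inl (Or.inl q1)
          by_cases q2 : M ≤ |u k x|
          · exact Or.inl (Or.inr q2)
          exact Or.inr ⟨(not_le.mp q1).le, (not_le.mp q2).le, hx⟩
      _ ≤ (η / 4 + η / 4) + η / 2 := by
          refine (measureReal_union_le _ _).trans (add_le_add ?_ s5)
          exact (measureReal_union_le _ _).trans (add_le_add (hmark j) (hmark k))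
      _ = η := by ring
  rw [measureReal_def] at s6
  rwa [ENNReal.le_ofReal_iff_toReal_le (measure_ne_top _ _) hη.le]

end Dat
end core2
end Obst

namespace Obst
section core3
variable {X : Type*} [MeasurableSpace X] {μ ν : Measure X} {m1 m2 : Measure (X × X)}
    {Ω : Set X} {g : X → ℝ} {h : X → EReal} {p : ℝ} {c1 C1 : NNReal}
namespace Dat

lemma lim_adm (D : Dat μ ν m1 m2 Ω g p c1 C1) {u0 u : X → ℝ} (hu0 : u0 ∈ Adm μ m1 Ω g h p) {v : ℕ → X → ℝ}
    (hv : ∀ i, v i ∈ Adm μ m1 Ω g h p) (hum : AEMeasurable u μ)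
    (hlim : ∀ᵐ x ∂μ, Tendsto (fun i => v i x) atTop (𝓝 (u x)))
    {W l1 : ℝ} (hW : ∀ i, ∫ x in Ω, |v i x - u0 x| ^ p ∂μ ≤ W)
    (hl1 : Tendsto (fun i => ∫ z, |dd (v i) z| ^ p ∂m1) atTop (𝓝 l1)) :
    u ∈ Adm μ m1 Ω g h p ∧ ∫ z, |dd u z| ^ p ∂m1 ≤ l1 := by
  have := D.sfin
  have hp := D.hp
  have hlim1 : ∀ᵐ z ∂m1, Tendsto (fun i => |dd (v i) z| ^ p) atTop (𝓝 (|dd u z| ^ p)) := by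
    filter_upwards [ae_fst D.hac1 hlim, ae_snd D.hac1 hlim] with z h1 h2
    exact ((phi_cont hp).tendsto _).comp (h1.sub h2)
  obtain ⟨i1, e1⟩ := fatou_real (m := m1) (f := fun i z => |dd (v i) z| ^ p)
    (fun i => (hv i).2.2.1) (fun i => Eventually.of_forall fun z => by positivity) hlim1
    (fun i => le_rfl) hl1
  have hlim2 : ∀ᵐ x ∂(μ.restrict Ω), Tendsto (fun i => |v i x - u0 x| ^ p) atTop
      (𝓝 (|u x - u0 x| ^ p)) := by
    filter_upwards [ae_restrict_of_ae hlim] with x hx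
    exact ((phi_cont hp).tendsto _).comp (hx.sub tendsto_const_nhds)
  obtain ⟨i2, e2⟩ := fatou_real (m := μ.restrict Ω) (f := fun i x => |v i x - u0 x| ^ p)
    (fun i => D.diffInt (hv i) hu0) (fun i => Eventually.of_forall fun z => by positivity) hlim2
    hW tendsto_const_nhds
  refine ⟨⟨hum, ?_, i1, ?_, ?_⟩, e1⟩
  · refine ((i2.add hu0.2.1).const_mul (2 ^ p)).mono' ?_ ?_
    · exact ((phi_cont hp).measurable.comp_aemeasurable hum.restrict).aestronglyMeasurable
    · filter_upwards with x
      rw [Real.norm_eq_abs, abs_of_nonneg (by positivity)]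
      have := add_rpow_le (by linarith : 0 ≤ p) (u x - u0 x) (u0 x)
      simpa using this
  · filter_upwards [hlim, ae_all_iff.mpr (fun i => (hv i).2.2.2.1)] with x h1 h2 hx
    have h3 : Tendsto (fun i => ((v i x : ℝ) : EReal)) atTop (𝓝 ((u x : ℝ) : EReal)) :=
      (continuous_coe_real_ereal.tendsto _).comp h1
    exact ge_of_tendsto' h3 (fun i => h2 i hx)
  · filter_upwards [hlim, ae_all_iff.mpr (fun i => (hv i).2.2.2.2)] with x h1 h2 hx
    refine tendsto_nhds_unique h1 ?_
    simp only [fun i => h2 i hx]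
    exact tendsto_const_nhds

lemma lim_far (D : Dat μ ν m1 m2 Ω g p c1 C1) {u0 u : X → ℝ} (hu0 : u0 ∈ Adm μ m1 Ω g h p) {v : ℕ → X → ℝ}
    (hv : ∀ i, v i ∈ Adm μ m1 Ω g h p) (hu : u ∈ Adm μ m1 Ω g h p)
    (hlim : ∀ᵐ x ∂μ, Tendsto (fun i => v i x) atTop (𝓝 (u x)))
    {W l2 : ℝ} (hW : ∀ i, ∫ x in Ω, |v i x - u0 x| ^ p ∂μ ≤ W)
    (hl2 : Tendsto (fun i => ∫ z, (|dd (v i) z| ^ p - |dd u0 z| ^ p) ∂m2) atTop (𝓝 l2)) :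
    ∫ z, (|dd u z| ^ p - |dd u0 z| ^ p) ∂m2 ≤ l2 := by
  have := D.sfin
  have := D.νfin
  have hp := D.hp
  set G : ℝ := ∫ y, (1 + |g y| ^ (p - 1)) ∂ν with hG
  have hG0 : 0 ≤ G := integral_nonneg (fun y => by positivity)
  have hC1 : (0:ℝ) ≤ C1 := C1.2
  have hW0 : 0 ≤ W := (integral_nonneg (fun y => by positivity)).trans (hW 0)
  have key : ∀ η : ℝ, 0 < η →
      ∫ z, (|dd u z| ^ p - |dd u0 z| ^ p) ∂m2 ≤ l2 + η * (C1 * (W * G)) := by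
    intro η hη
    obtain ⟨C, hC, hlow⟩ := far_lower hp η hη
    set B3 := ∫ z : X × X, (|u0 z.1| ^ p + |g z.2| ^ (p - 1)) ∂m2 with hB3
    have I4 := D.errInt hu0
    have hsplit : ∀ w ∈ Adm μ m1 Ω g h p,
        Integrable (fun z => (|dd w z| ^ p - |dd u0 z| ^ p) +
          (η * (|w z.1 - u0 z.1| ^ p * (1 + |g z.2| ^ (p - 1))) +
            C * (|u0 z.1| ^ p + |g z.2| ^ (p - 1)))) m2 ∧
        ∫ z, ((|dd w z| ^ p - |dd u0 z| ^ p) +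
          (η * (|w z.1 - u0 z.1| ^ p * (1 + |g z.2| ^ (p - 1))) +
            C * (|u0 z.1| ^ p + |g z.2| ^ (p - 1)))) ∂m2 =
        ∫ z, (|dd w z| ^ p - |dd u0 z| ^ p) ∂m2 +
          (η * (∫ z : X × X, |w z.1 - u0 z.1| ^ p * (1 + |g z.2| ^ (p - 1)) ∂m2) + C * B3) := by
      intro w hw
      have I2 := D.phiInt2 hu0 hw
      have I3 := D.farInt hw hu0
      have e1 := integral_add I2 ((I3.const_mul η).add (I4.const_mul C))
      have e2 := integral_add (I3.const_mul η) (I4.const_mul C)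
      simp only [Pi.add_apply] at e1
      refine ⟨I2.add ((I3.const_mul η).add (I4.const_mul C)), ?_⟩
      rw [e1, e2, integral_const_mul, integral_const_mul]
    have hbd : ∀ w ∈ Adm μ m1 Ω g h p, ∫ x in Ω, |w x - u0 x| ^ p ∂μ ≤ W →
        ∫ z : X × X, |w z.1 - u0 z.1| ^ p * (1 + |g z.2| ^ (p - 1)) ∂m2 ≤ C1 * (W * G) := by
      intro w hw hle
      refine (D.int_up (D.diffInt hw hu0) D.weightInt (fun x => by positivity)
        (fun x => by positivity)).trans ?_
      gcongr
    have hl : ∀ᵐ z ∂m2, Tendsto (fun i => (|dd (v i) z| ^ p - |dd u0 z| ^ p) +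
          (η * (|v i z.1 - u0 z.1| ^ p * (1 + |g z.2| ^ (p - 1))) +
            C * (|u0 z.1| ^ p + |g z.2| ^ (p - 1)))) atTop
          (𝓝 ((|dd u z| ^ p - |dd u0 z| ^ p) +
          (η * (|u z.1 - u0 z.1| ^ p * (1 + |g z.2| ^ (p - 1))) +
            C * (|u0 z.1| ^ p + |g z.2| ^ (p - 1))))) := by
      filter_upwards [ae_fst D.hac2 hlim, ae_snd D.hac2 hlim] with z h1 h2
      have t1 : Tendsto (fun i => |dd (v i) z| ^ p) atTop (𝓝 (|dd u z| ^ p)) :=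
        ((phi_cont hp).tendsto _).comp (h1.sub h2)
      have t2 : Tendsto (fun i => |v i z.1 - u0 z.1| ^ p) atTop (𝓝 (|u z.1 - u0 z.1| ^ p)) :=
        ((phi_cont hp).tendsto _).comp (h1.sub tendsto_const_nhds)
      exact (t1.sub tendsto_const_nhds).add
        (((t2.mul tendsto_const_nhds).const_mul η).add tendsto_const_nhds)
    obtain ⟨-, hf⟩ := fatou_real (m := m2) (fun i => (hsplit (v i) (hv i)).1) (fun i => by
        filter_upwards [D.farg (hv i), D.farg hu0] with z h1 h2
        have := hlow (v i z.1) (u0 z.1) (g z.2)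
        have q : 0 ≤ (2 ^ p)⁻¹ * |v i z.1 - u0 z.1| ^ p := by positivity
        simp only [dd, h1, h2]
        linarith) hl
      (b := fun i => ∫ z, (|dd (v i) z| ^ p - |dd u0 z| ^ p) ∂m2 +
        (η * (C1 * (W * G)) + C * B3))
      (fun i => by
        rw [(hsplit (v i) (hv i)).2]
        have := mul_le_mul_of_nonneg_left (hbd (v i) (hv i) (hW i)) hη.le
        linarith)
      (hl2.add tendsto_const_nhds)
    rw [(hsplit u hu).2] at hf
    have : 0 ≤ η * ∫ z : X × X, |u z.1 - u0 z.1| ^ p * (1 + |g z.2| ^ (p - 1)) ∂m2 :=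
      mul_nonneg hη.le (integral_nonneg fun z => by positivity)
    linarith
  refine le_of_forall_pos_le_add (fun ε hε => ?_)
  have hT : 0 ≤ (C1:ℝ) * (W * G) := by positivity
  refine (key (ε / (C1 * (W * G) + 1)) (by positivity)).trans ?_
  have : ε / (C1 * (W * G) + 1) * (C1 * (W * G)) ≤ ε := by
    rw [div_mul_eq_mul_div, div_le_iff₀ (by positivity)]
    nlinarith
  linarith

lemma exists_min (D : Dat μ ν m1 m2 Ω g p c1 C1) (hne : (Adm μ m1 Ω g h p).Nonempty) :
    ∃ u ∈ Adm μ m1 Ω g h p, ∀ v ∈ Adm μ m1 Ω g h p,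
      0 ≤ ∫ z, (|dd v z| ^ p - |dd u z| ^ p) ∂(mm m1 m2) := by
  have := D.sfin
  have hp := D.hp
  obtain ⟨u0, hu0⟩ := hne
  obtain ⟨c, hc, B, hcoer⟩ := D.coercive hu0
  set J : (X → ℝ) → ℝ := fun u => ∫ z, (|dd u z| ^ p - |dd u0 z| ^ p) ∂(mm m1 m2) with hJ
  have hJ1nn : ∀ u : X → ℝ, 0 ≤ ∫ z, |dd u z| ^ p ∂m1 :=
    fun u => integral_nonneg fun z => by positivity
  have hWnn : ∀ u : X → ℝ, 0 ≤ ∫ x in Ω, |u x - u0 x| ^ p ∂μ :=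
    fun u => integral_nonneg fun z => by positivity
  set I := sInf (J '' Adm μ m1 Ω g h p) with hI
  have hbdd : BddBelow (J '' Adm μ m1 Ω g h p) := by
    refine ⟨-B, ?_⟩
    rintro _ ⟨u, hu, rfl⟩
    have h1 := hcoer u hu
    have h2 := mul_nonneg hc.le (hWnn u)
    have h3 := hJ1nn u
    simp only [hJ]
    linarith
  have hIle : ∀ u ∈ Adm μ m1 Ω g h p, I ≤ J u := fun u hu => csInf_le hbdd ⟨u, hu, rfl⟩
  have hex : ∀ j : ℕ, ∃ u ∈ Adm μ m1 Ω g h p, J u < I + 1 / ((j:ℝ) + 1) := by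
    intro j
    have hlt : I < I + 1 / ((j:ℝ) + 1) := by
      have : 0 < 1 / ((j:ℝ) + 1) := by positivity
      linarith
    obtain ⟨_, ⟨u, hu, rfl⟩, h2⟩ := exists_lt_of_csInf_lt (Set.Nonempty.image J ⟨u0, hu0⟩) hlt
    exact ⟨u, hu, h2⟩
  choose u hu hJu using hex
  have hJlim : Tendsto (fun j => J (u j)) atTop (𝓝 I) := by
    refine tendsto_of_tendsto_of_tendsto_of_le_of_le tendsto_const_nhds ?_
      (fun j => hIle _ (hu j)) (fun j => (hJu j).le)
    simpa using (tendsto_const_nhds (x := I)).add (tendsto_one_div_add_atTop_nhds_zero_nat (𝕜 := ℝ))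
  set T : ℝ := I + 1 + B with hT
  have hbnd : ∀ j, c * (∫ x in Ω, |u j x - u0 x| ^ p ∂μ) + ∫ z, |dd (u j) z| ^ p ∂m1 ≤ T := by
    intro j
    have h1 := hcoer (u j) (hu j)
    have h2 := hJu j
    have h3 : 1 / ((j:ℝ) + 1) ≤ 1 := by
      rw [div_le_one (by positivity)]
      have : (0:ℝ) ≤ j := by positivity
      linarith
    simp only [hJ] at h2
    linarith
  have hWb : ∀ j, ∫ x in Ω, |u j x - u0 x| ^ p ∂μ ≤ T / c := by
    intro j
    rw [le_div_iff₀ hc]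
    linarith [hbnd j, hJ1nn (u j)]
  have hJ1b : ∀ j, ∫ z, |dd (u j) z| ^ p ∂m1 ≤ T := by
    intro j
    linarith [hbnd j, mul_nonneg hc.le (hWnn (u j))]
  have hLb : ∀ j, ∫ x in Ω, |u j x| ^ p ∂μ ≤ 2 ^ p * (T / c + ∫ x in Ω, |u0 x| ^ p ∂μ) := by
    intro j
    have i1 := D.diffInt (hu j) hu0
    calc ∫ x in Ω, |u j x| ^ p ∂μ
        ≤ ∫ x in Ω, 2 ^ p * (|u j x - u0 x| ^ p + |u0 x| ^ p) ∂μ := by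
          refine integral_mono (hu j).2.1 ((i1.add hu0.2.1).const_mul _) (fun x => ?_)
          have := add_rpow_le (by linarith : 0 ≤ p) (u j x - u0 x) (u0 x)
          simpa using this
      _ = 2 ^ p * (∫ x in Ω, |u j x - u0 x| ^ p ∂μ + ∫ x in Ω, |u0 x| ^ p ∂μ) := by
          rw [integral_const_mul, integral_add i1 hu0.2.1]
      _ ≤ _ := by
          have := hWb j
          gcongr
  have hm2 : m2 ≤ mm m1 m2 := by
    unfold mm
    exact (Measure.le_add_left le_rfl).trans (Measure.le_add_left le_rfl)
  have hC := D.cauchy_step hu hLb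
    (fun j k => by
      obtain ⟨w, hw, hi, -⟩ := D.mid_int (hu j) (hu k) hu0
      exact hi.mono_measure hm2)
    (fun j k => by
      obtain ⟨w, hw, hi, he⟩ := D.mid_int (hu j) (hu k) hu0
      refine (integral_mono_measure hm2 (Eventually.of_forall fun z => phi_mid_nonneg hp _ _)
        hi).trans ?_
      rw [he]
      have a1 := hIle w hw
      have a2 := hJu j
      have a3 := hJu k
      simp only [hJ] at a1 a2 a3
      linarith)
  obtain ⟨ns, hns, F, hF, hlimF⟩ := cauchy_in_measure (fun j => (hu j).1.restrict) hC
  obtain ⟨l1, -, θ, hθ, hl1⟩ := tendsto_subseq_of_bounded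
    (isBounded_Icc (0:ℝ) T) (x := fun i => ∫ z, |dd (u (ns i)) z| ^ p ∂m1)
    (fun i => ⟨hJ1nn _, hJ1b _⟩)
  classical
  set w : X → ℝ := Ω.piecewise F g with hw
  set v : ℕ → X → ℝ := fun i => u (ns (θ i)) with hv
  have hvA : ∀ i, v i ∈ Adm μ m1 Ω g h p := fun i => hu _
  have hwm : AEMeasurable w μ := by
    refine ⟨Ω.piecewise F (D.hg.mk g), hF.piecewise D.hΩ D.hg.measurable_mk, ?_⟩
    filter_upwards [D.hg.ae_eq_mk] with x hx
    simp only [hw, Set.piecewise, hx]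
  have hlim : ∀ᵐ x ∂μ, Tendsto (fun i => v i x) atTop (𝓝 (w x)) := by
    rw [ae_restrict_iff' D.hΩ] at hlimF
    filter_upwards [hlimF, ae_all_iff.mpr (fun i => (hvA i).2.2.2.2)] with x h1 h2
    by_cases hx : x ∈ Ω
    · simp only [hw, Set.piecewise_eq_of_mem _ _ _ hx]
      exact (h1 hx).comp hθ.tendsto_atTop
    · simp only [hw, Set.piecewise_eq_of_notMem _ _ _ hx]
      simp only [fun i => h2 i hx]
      exact tendsto_const_nhds
  have hl1' : Tendsto (fun i => ∫ z, |dd (v i) z| ^ p ∂m1) atTop (𝓝 l1) := hl1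
  have hWv : ∀ i, ∫ x in Ω, |v i x - u0 x| ^ p ∂μ ≤ T / c := fun i => hWb _
  obtain ⟨hwA, hw1⟩ := D.lim_adm hu0 hvA hwm hlim hWv hl1'
  have hJv : Tendsto (fun i => J (v i)) atTop (𝓝 I) :=
    hJlim.comp (hns.tendsto_atTop.comp hθ.tendsto_atTop)
  have hl2 : Tendsto (fun i => ∫ z, (|dd (v i) z| ^ p - |dd u0 z| ^ p) ∂m2) atTop
      (𝓝 ((I - l1 + ∫ z, |dd u0 z| ^ p ∂m1) / 2)) := by
    refine (((hJv.sub hl1').add tendsto_const_nhds).div_const 2).congr (fun i => ?_)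
    simp only [hJ]
    rw [D.J_split (hvA i) hu0]
    ring
  have hw2 := D.lim_far hu0 hvA hwA hlim hWv hl2
  have hJw : J w ≤ I := by
    simp only [hJ]
    rw [D.J_split hwA hu0]
    linarith
  refine ⟨w, hwA, fun y hy => ?_⟩
  have e : ∫ z, (|dd y z| ^ p - |dd w z| ^ p) ∂(mm m1 m2) = J y - J w := by
    simp only [hJ]
    rw [← integral_sub (D.phiInt hu0 hy) (D.phiInt hu0 hwA)]
    congr 1; funext z; ring
  rw [e]
  linarith [hIle y hy]

end Dat
end core3
end Obst

namespace Obst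

section concrete
variable {n : ℕ} {s p Λ : ℝ} {K : Euc n → Euc n → ℝ} {Ω Ω' : Set (Euc n)}
  {g : Euc n → ℝ} {h : Euc n → EReal}

/-- The density. -/
noncomputable def kap (K : Euc n → Euc n → ℝ) (z : Euc n × Euc n) : NNReal :=
  (K z.1 z.2).toNNReal

/-- The weight. -/
noncomputable def wt (n : ℕ) (s p : ℝ) (y : Euc n) : NNReal :=
  ((1 + ‖y‖) ^ (-((n:ℝ) + s * p))).toNNReal

/-- Near measure. -/
noncomputable def M1 (K : Euc n → Euc n → ℝ) (Ω' : Set (Euc n)) : Measure (Euc n × Euc n) :=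
  ((volume.restrict Ω').prod (volume.restrict Ω')).withDensity (fun z => (kap K z : ℝ≥0∞))

/-- Far measure. -/
noncomputable def M2 (K : Euc n → Euc n → ℝ) (Ω Ω' : Set (Euc n)) : Measure (Euc n × Euc n) :=
  ((volume.restrict Ω).prod (volume.restrict Ω'ᶜ)).withDensity (fun z => (kap K z : ℝ≥0∞))

/-- Weighted measure. -/
noncomputable def Nu (s p : ℝ) (Ω' : Set (Euc n)) : Measure (Euc n) :=
  (volume.restrict Ω'ᶜ).withDensity (fun y => (wt n s p y : ℝ≥0∞))

lemma kap_meas (hK : IsKernel n s p Λ K) : Measurable (kap K) :=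
  Measurable.real_toNNReal hK.1

lemma wt_meas : Measurable (wt n s p) := by
  unfold wt
  refine Measurable.real_toNNReal ?_
  exact (measurable_const.add measurable_norm).pow_const _

lemma base_ac (A B : Set (Euc n)) :
    (volume.restrict A).prod (volume.restrict B) ≪
      (volume : Measure (Euc n)).prod (volume : Measure (Euc n)) := by
  rw [Measure.prod_restrict]
  exact Measure.absolutelyContinuous_of_le Measure.restrict_le_self

lemma base_mem {A B : Set (Euc n)} (hA : MeasurableSet A) (hB : MeasurableSet B) :
    ∀ᵐ z ∂((volume.restrict A).prod (volume.restrict B)), z.1 ∈ A ∧ z.2 ∈ B := by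
  rw [Measure.prod_restrict]
  filter_upwards [ae_restrict_mem (hA.prod hB)] with z hz using hz

lemma base_K (hK : IsKernel n s p Λ K) (A B : Set (Euc n)) :
    ∀ᵐ z ∂((volume.restrict A).prod (volume.restrict B)),
      Λ⁻¹ ≤ K z.1 z.2 * ‖z.1 - z.2‖ ^ ((n : ℝ) + s * p) ∧
      K z.1 z.2 * ‖z.1 - z.2‖ ^ ((n : ℝ) + s * p) ≤ Λ :=
  (base_ac A B).ae_le hK.2.2.2

lemma kap_coe (hK : IsKernel n s p Λ K) (z : Euc n × Euc n) : (kap K z : ℝ) = K z.1 z.2 :=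
  Real.coe_toNNReal _ (hK.2.2.1 _ _)

lemma wt_coe (y : Euc n) : (wt n s p y : ℝ) = (1 + ‖y‖) ^ (-((n:ℝ) + s * p)) :=
  Real.coe_toNNReal _ (by positivity)

lemma wt_integrable (hs0 : 0 < s) (hp : 1 < p) :
    Integrable (fun y : Euc n => (1 + ‖y‖) ^ (-((n:ℝ) + s * p))) volume := by
  refine integrable_one_add_norm ?_
  have : 0 < s * p := by positivity
  simp only [finrank_euclideanSpace, Fintype.card_fin]
  linarith

lemma nu_fin (hs0 : 0 < s) (hp : 1 < p) : IsFiniteMeasure (Nu s p Ω') :=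
  isFiniteMeasure_withDensity_ofReal (wt_integrable hs0 hp).restrict.2

lemma nu_ne (hn : 1 ≤ n) (hΩ'o : IsOpen Ω') (hΩ'b : Bornology.IsBounded Ω') :
    Nu s p Ω' ≠ 0 := by
  intro h0
  have h1 := (withDensity_eq_zero_iff (wt_meas.coe_nnreal_ennreal.aemeasurable)).mp h0
  have h2 : ∀ᵐ y ∂((volume : Measure (Euc n)).restrict Ω'ᶜ), False := by
    filter_upwards [h1] with y hy
    have h3 : wt n s p y = 0 := by simpa using hy
    have h4 := wt_coe (n := n) (s := s) (p := p) y
    rw [h3] at h4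
    have : 0 < (1 + ‖y‖) ^ (-((n:ℝ) + s * p)) := by positivity
    rw [NNReal.coe_zero] at h4
    linarith
  have h3 : (volume : Measure (Euc n)) Ω'ᶜ = 0 := by
    simpa [ae_iff] using h2
  have : Nonempty (Fin n) := ⟨⟨0, hn⟩⟩
  have : NoncompactSpace (Euc n) := NormedSpace.noncompactSpace ℝ (Euc n)
  have h4 := measure_univ_of_isAddLeftInvariant (volume : Measure (Euc n))
  have h5 := measure_add_measure_compl (μ := (volume : Measure (Euc n))) hΩ'o.measurableSet
  rw [h3, h4, add_zero] at h5
  exact hΩ'b.measure_lt_top.ne h5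

lemma tail_int (hs0 : 0 < s) (hp : 1 < p) (hgt : MemTail n s p g) :
    Integrable (fun y => |g y| ^ (p - 1)) (Nu s p Ω') := by
  refine (integrable_withDensity_iff_integrable_smul wt_meas).mpr ?_
  refine Integrable.restrict ?_
  have hm : AEStronglyMeasurable (fun y => wt n s p y • |g y| ^ (p - 1)) volume := by
    refine AEMeasurable.aestronglyMeasurable ?_
    exact wt_meas.aemeasurable.smul ((phi1_cont hp).measurable.comp_aemeasurable hgt.1)
  have hq : 0 < (n:ℝ) + s * p := by positivity
  rw [← integrableOn_univ, ← Set.union_compl_self (ball (0 : Euc n) 1)]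
  refine IntegrableOn.union ?_ ?_
  · refine (hgt.2.1 0 1 one_pos).mono' hm.restrict ?_
    filter_upwards with y
    rw [NNReal.smul_def, wt_coe, smul_eq_mul, Real.norm_eq_abs, abs_of_nonneg (by positivity)]
    refine mul_le_of_le_one_left (by positivity) ?_
    exact Real.rpow_le_one_of_one_le_of_nonpos (by linarith [norm_nonneg y]) (by linarith)
  · refine (hgt.2.2 0 1 one_pos).mono' hm.restrict ?_
    filter_upwards [ae_restrict_mem measurableSet_ball.compl] with y hy
    have hy1 : 1 ≤ ‖y‖ := by simpa using hy
    rw [NNReal.smul_def, wt_coe, smul_eq_mul, Real.norm_eq_abs, abs_of_nonneg (by positivity),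
      mul_comm, sub_zero]
    gcongr ?_ * ?_
    exact Real.rpow_le_rpow_of_nonpos (by linarith) (by linarith) (by linarith)

lemma k_bounds {q R d Λ x y k a b : ℝ} (hq : 0 < q) (hR : 0 ≤ R) (hd : 0 < d) (hΛ : 1 ≤ Λ)
    (hy : 0 ≤ y) (hx : x ≤ R) (had : d ≤ a) (h1 : a ≤ x + y) (h2 : y ≤ x + a)
    (hl : Λ⁻¹ ≤ k * a ^ q) (hu : k * a ^ q ≤ Λ) (hb : b = (1 + y) ^ (-q)) :
    Λ⁻¹ * ((1 + R) ^ q)⁻¹ * b ≤ k ∧ k ≤ Λ * ((1 + R) / d + 1) ^ q * b := by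
  have ha : 0 < a := by linarith
  have haq : 0 < a ^ q := by positivity
  have hyq : 0 < (1 + y) ^ q := by positivity
  rw [Real.rpow_neg (by positivity)] at hb
  subst hb
  constructor
  · have e1 : a ^ q ≤ (1 + R) ^ q * (1 + y) ^ q := by
      rw [← Real.mul_rpow (by positivity) (by positivity)]
      exact Real.rpow_le_rpow ha.le (by nlinarith) hq.le
    have e2 : Λ⁻¹ * (a ^ q)⁻¹ ≤ k := by
      rwa [← div_eq_mul_inv, div_le_iff₀ haq]
    refine le_trans ?_ e2
    rw [mul_assoc, ← mul_inv]
    have : 0 < Λ := by linarith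
    gcongr
  · have e1 : (1 + y) ^ q ≤ ((1 + R) / d + 1) ^ q * a ^ q := by
      rw [← Real.mul_rpow (by positivity) (by positivity)]
      refine Real.rpow_le_rpow (by positivity) ?_ hq.le
      have : 1 + R ≤ (1 + R) / d * a := by
        rw [div_mul_eq_mul_div, le_div_iff₀ hd]
        nlinarith
      nlinarith
    have e2 : k ≤ Λ * (a ^ q)⁻¹ := by
      rwa [← div_eq_mul_inv, le_div_iff₀ haq]
    refine e2.trans ?_
    rw [mul_assoc]
    have : 0 < Λ := by linarith
    gcongr
    rw [← div_eq_mul_inv, le_div_iff₀ hyq, inv_mul_le_iff₀ haq]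
    linarith

lemma mk_dat (hn : 1 ≤ n) (hs0 : 0 < s) (hp : 1 < p)
    (hΛ : 1 ≤ Λ) (hK : IsKernel n s p Λ K)
    (hΩo : IsOpen Ω) (hΩ'o : IsOpen Ω')
    (hΩb : Bornology.IsBounded Ω) (hΩ'b : Bornology.IsBounded Ω') (hΩΩ' : closure Ω ⊆ Ω')
    (hgt : MemTail n s p g) :
    ∃ c1 C1 : NNReal, Dat volume (Nu s p Ω') (M1 K Ω') (M2 K Ω Ω') Ω g p c1 C1 := by
  obtain ⟨d, hd, hdsub⟩ := hΩb.isCompact_closure.exists_thickening_subset_open hΩ'o hΩΩ'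
  obtain ⟨R0, hR0⟩ := hΩb.exists_norm_le
  set R := max R0 0 with hR
  have hR0' : 0 ≤ R := le_max_right _ _
  have hq : 0 < (n:ℝ) + s * p := by positivity
  have hΛ0 : 0 < Λ := by linarith
  have hpt : ∀ᵐ z ∂((volume.restrict Ω).prod (volume.restrict Ω'ᶜ)),
      Λ⁻¹ * ((1 + R) ^ ((n:ℝ) + s * p))⁻¹ * (wt n s p z.2 : ℝ) ≤ K z.1 z.2 ∧
      K z.1 z.2 ≤ Λ * ((1 + R) / d + 1) ^ ((n:ℝ) + s * p) * (wt n s p z.2 : ℝ) := by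
    filter_upwards [base_mem hΩo.measurableSet hΩ'o.measurableSet.compl, base_K hK Ω Ω'ᶜ]
      with z hz1 hz2
    refine k_bounds (x := ‖z.1‖) (y := ‖z.2‖) (a := ‖z.1 - z.2‖) hq hR0' hd hΛ (norm_nonneg _)
      ((hR0 _ hz1.1).trans (le_max_left _ _)) ?_ (norm_sub_le _ _) ?_ hz2.1 hz2.2 (wt_coe _)
    · by_contra hcon
      push Not at hcon
      refine hz1.2 (hdsub ?_)
      rw [mem_thickening_iff]
      refine ⟨z.1, subset_closure hz1.1, ?_⟩
      rwa [dist_comm, dist_eq_norm]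
    · have := norm_sub_norm_le z.2 z.1
      rw [norm_sub_rev] at this
      linarith
  have hprod : (volume.restrict Ω).prod (Nu s p Ω') =
      ((volume.restrict Ω).prod (volume.restrict Ω'ᶜ)).withDensity
        (fun z => (wt n s p z.2 : ℝ≥0∞)) := prod_withDensity_right wt_meas.coe_nnreal_ennreal
  have hsm : ∀ c : NNReal, c • ((volume.restrict Ω).prod (Nu s p Ω')) =
      ((volume.restrict Ω).prod (volume.restrict Ω'ᶜ)).withDensity
        (fun z => ((c * wt n s p z.2 : NNReal) : ℝ≥0∞)) := by
    intro c
    have e := withDensity_smul (μ := (volume.restrict Ω).prod (volume.restrict Ω'ᶜ)) (c : ℝ≥0∞)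
      (f := fun z => (wt n s p z.2 : ℝ≥0∞)) (wt_meas.comp measurable_snd).coe_nnreal_ennreal
    rw [hprod]
    refine e.symm.trans ?_
    congr 1
  refine ⟨(Λ⁻¹ * ((1 + R) ^ ((n:ℝ) + s * p))⁻¹).toNNReal,
    (Λ * ((1 + R) / d + 1) ^ ((n:ℝ) + s * p)).toNNReal, ?_⟩
  refine
   { hp := hp
     hΩ := hΩo.measurableSet
     hfin := hΩb.measure_lt_top
     sfin := inferInstance
     νfin := nu_fin hs0 hp
     ν0 := nu_ne hn hΩ'o hΩ'b
     hac1 := (withDensity_absolutelyContinuous _ _).trans (base_ac _ _)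
     hac2 := (withDensity_absolutelyContinuous _ _).trans (base_ac _ _)
     hc1 := Real.toNNReal_pos.mpr (by positivity)
     hlow := ?_
     hup := ?_
     hνΩ := ?_
     hg := hgt.1
     hgi := tail_int hs0 hp hgt }
  · rw [hsm]
    refine withDensity_mono ?_
    filter_upwards [hpt] with z hz
    rw [ENNReal.coe_le_coe, ← NNReal.coe_le_coe, NNReal.coe_mul, kap_coe hK,
      Real.coe_toNNReal _ (by positivity)]
    exact hz.1
  · rw [hsm]
    refine withDensity_mono ?_
    filter_upwards [hpt] with z hz
    rw [ENNReal.coe_le_coe, ← NNReal.coe_le_coe, NNReal.coe_mul, kap_coe hK,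
      Real.coe_toNNReal _ (by positivity)]
    exact hz.2
  · refine (withDensity_absolutelyContinuous _ _).ae_le ?_
    filter_upwards [ae_restrict_mem hΩ'o.measurableSet.compl] with y hy hyΩ
    exact hy (hΩΩ' (subset_closure hyΩ))

lemma gag_iff (hp : 1 < p) (hΛ : 1 ≤ Λ) (hK : IsKernel n s p Λ K) {u : Euc n → ℝ}
    (hu : AEMeasurable u (volume.restrict Ω')) :
    Integrable (fun z : Euc n × Euc n => |u z.1 - u z.2| ^ p) (M1 K Ω') ↔
    Integrable (fun q : Euc n × Euc n => |u q.1 - u q.2| ^ p / ‖q.1 - q.2‖ ^ ((n : ℝ) + s * p))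
      ((volume.restrict Ω').prod (volume.restrict Ω')) := by
  unfold M1
  rw [integrable_withDensity_iff_integrable_smul (kap_meas hK)]
  have hΛ0 : 0 < Λ := by linarith
  have hm : AEMeasurable (fun z : Euc n × Euc n => |u z.1 - u z.2| ^ p)
      ((volume.restrict Ω').prod (volume.restrict Ω')) :=
    (phi_cont hp).measurable.comp_aemeasurable (dd_meas Measure.AbsolutelyContinuous.rfl hu)
  have hpt : ∀ᵐ z ∂((volume.restrict Ω').prod (volume.restrict Ω')),
      K z.1 z.2 ≤ Λ * (‖z.1 - z.2‖ ^ ((n : ℝ) + s * p))⁻¹ ∧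
      (‖z.1 - z.2‖ ^ ((n : ℝ) + s * p))⁻¹ ≤ Λ * K z.1 z.2 := by
    filter_upwards [base_K hK Ω' Ω'] with z hz
    have h0 : 0 < ‖z.1 - z.2‖ ^ ((n : ℝ) + s * p) := by
      refine lt_of_le_of_ne (by positivity) (fun h => ?_)
      rw [← h, mul_zero] at hz
      have : 0 < Λ⁻¹ := by positivity
      linarith [hz.1]
    refine ⟨?_, ?_⟩
    · rw [← div_eq_mul_inv, le_div_iff₀ h0]; exact hz.2
    · rw [inv_le_iff_one_le_mul₀ h0]
      have := hz.1
      rw [inv_le_iff_one_le_mul₀ hΛ0] at this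
      linarith
  constructor
  · intro hi
    refine (hi.const_mul Λ).mono' ?_ ?_
    · refine (hm.div ?_).aestronglyMeasurable
      exact ((measurable_fst.sub measurable_snd).norm.pow_const _).aemeasurable
    · filter_upwards [hpt] with z hz
      rw [Real.norm_eq_abs, abs_of_nonneg (by positivity), NNReal.smul_def, smul_eq_mul, kap_coe hK,
        div_eq_mul_inv]
      have := mul_le_mul_of_nonneg_left hz.2 (show 0 ≤ |u z.1 - u z.2| ^ p by positivity)
      linarith
  · intro hi
    refine (hi.const_mul Λ).mono' ?_ ?_
    · exact ((kap_meas hK).aemeasurable.smul hm).aestronglyMeasurable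
    · filter_upwards [hpt] with z hz
      have hK0 := hK.2.2.1 z.1 z.2
      rw [NNReal.smul_def, smul_eq_mul, kap_coe hK, Real.norm_eq_abs, abs_of_nonneg (by positivity),
        div_eq_mul_inv]
      have := mul_le_mul_of_nonneg_left hz.1 (show 0 ≤ |u z.1 - u z.2| ^ p by positivity)
      linarith

lemma adm_eq (hp : 1 < p) (hΛ : 1 ≤ Λ) (hK : IsKernel n s p Λ K)
    (hΩo : IsOpen Ω) (hΩ'o : IsOpen Ω') (hsub : Ω ⊆ Ω')
    (hg : MemW n s p Ω' g) (hgt : MemTail n s p g) :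
    obstacleSet n s p Ω Ω' g h = Adm volume (M1 K Ω') Ω g h p := by
  ext u
  constructor
  · rintro ⟨⟨h1, h2, h3⟩, h4, h5⟩
    refine ⟨?_, h2.mono_set hsub, (gag_iff hp hΛ hK h1).mpr h3, h4, h5⟩
    rw [← Measure.restrict_add_restrict_compl (μ := volume) hΩ'o.measurableSet,
      aemeasurable_add_measure_iff]
    refine ⟨h1, hgt.1.restrict.congr ?_⟩
    filter_upwards [ae_restrict_of_ae h5, ae_restrict_mem hΩ'o.measurableSet.compl] with x hx hx'
    exact (hx (fun hc => hx' (hsub hc))).symm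
  · rintro ⟨h1, h2, h3, h4, h5⟩
    refine ⟨⟨h1.restrict, ?_, (gag_iff hp hΛ hK h1.restrict).mp h3⟩, h4, h5⟩
    have e : Ω' = Ω ∪ (Ω' \ Ω) := (Set.union_sdiff_cancel hsub).symm
    rw [e]
    refine IntegrableOn.union h2 ?_
    have i1 : IntegrableOn (fun x => |g x| ^ p) (Ω' \ Ω) volume := hg.2.1.mono_set Set.sdiff_subset
    refine Integrable.congr i1 ?_
    filter_upwards [ae_restrict_of_ae h5,
      ae_restrict_mem (hΩ'o.measurableSet.diff hΩo.measurableSet)] with x hx hx'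
    rw [hx hx'.2]

lemma Aop_eq (hK : IsKernel n s p Λ K) {c1 C1 : NNReal}
    (D : Dat volume (Nu s p Ω') (M1 K Ω') (M2 K Ω Ω') Ω g p c1 C1) {u v : Euc n → ℝ}
    (hu : u ∈ Adm volume (M1 K Ω') Ω g h p) (hv : v ∈ Adm volume (M1 K Ω') Ω g h p) :
    Aop n p Ω Ω' g K u (fun x => v x - u x) =
      ∫ z, Lg p (dd u z) * (dd v z - dd u z) ∂(mm (M1 K Ω') (M2 K Ω Ω')) := by
  have i := D.LgInt hu hv
  have i1 := i.left_of_add_measure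
  have i2 := i.right_of_add_measure.right_of_add_measure
  have ec : (fun z => Lg p (dd u z) * (dd v z - dd u z)) =ᵐ[M2 K Ω Ω']
      (fun z => Lg p (u z.1 - g z.2) * (v z.1 - u z.1)) := by
    filter_upwards [D.farg hu, D.farg hv] with z h1 h2
    simp only [dd, h1, h2]
    congr 1; ring
  have i3 := i2.congr ec
  unfold mm
  rw [integral_add_measure i1 (i2.add_measure i2), integral_add_measure i2 i2,
    integral_congr_ae ec, ← two_mul]
  unfold M1 at i1 ⊢
  unfold M2 at i3 ⊢
  rw [integrable_withDensity_iff_integrable_smul (kap_meas hK)] at i1 i3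
  rw [integral_withDensity_eq_integral_smul (kap_meas hK),
    integral_withDensity_eq_integral_smul (kap_meas hK), integral_prod _ i1,
    integral_prod_symm _ i3]
  unfold Aop
  congr 1
  · congr 1; funext x; congr 1; funext y
    rw [NNReal.smul_def, smul_eq_mul, kap_coe hK]
    simp only [dd, Lf, Lg]
    ring
  · congr 2; funext y; congr 1; funext x
    rw [NNReal.smul_def, smul_eq_mul, kap_coe hK]
    simp only [Lf, Lg]
    ring

end concrete
end Obst

/-- Theorem 3.2 (existence and uniqueness): there exists a solution to the obstacle problem
in `K_{g,h}(Ω,Ω')`, and any two solutions agree almost everywhere. -/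
theorem obstacle_problem_existence_uniqueness
    (n : ℕ) (s p Λ : ℝ) (hn : 1 ≤ n) (hs0 : 0 < s) (hs1 : s < 1) (hp : 1 < p)
    (hΛ : 1 ≤ Λ) (K : Euc n → Euc n → ℝ) (hK : IsKernel n s p Λ K)
    (Ω Ω' : Set (Euc n)) (hΩo : IsOpen Ω) (hΩ'o : IsOpen Ω')
    (hΩb : Bornology.IsBounded Ω) (hΩ'b : Bornology.IsBounded Ω') (hΩΩ' : closure Ω ⊆ Ω')
    (g : Euc n → ℝ) (h : Euc n → EReal)
    (hg : MemW n s p Ω' g) (hgt : MemTail n s p g)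
    (hne : (obstacleSet n s p Ω Ω' g h).Nonempty) :
    (∃ u : Euc n → ℝ, SolvesObstacle n s p Ω Ω' g h K u) ∧
    ∀ u₁ u₂ : Euc n → ℝ, SolvesObstacle n s p Ω Ω' g h K u₁ →
      SolvesObstacle n s p Ω Ω' g h K u₂ →
      ∀ᵐ x ∂(volume : Measure (Euc n)), u₁ x = u₂ x := by
  have hsub : Ω ⊆ Ω' := subset_closure.trans hΩΩ'
  obtain ⟨c1, C1, D⟩ := Obst.mk_dat (g := g) hn hs0 hp hΛ hK hΩo hΩ'o hΩb hΩ'b hΩΩ' hgt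
  have hA := Obst.adm_eq (h := h) hp hΛ hK hΩo hΩ'o hsub hg hgt
  have hiff : ∀ u, SolvesObstacle n s p Ω Ω' g h K u ↔
      u ∈ Obst.Adm volume (Obst.M1 K Ω') Ω g h p ∧
      ∀ v ∈ Obst.Adm volume (Obst.M1 K Ω') Ω g h p,
        0 ≤ ∫ z, Obst.Lg p (Obst.dd u z) * (Obst.dd v z - Obst.dd u z)
          ∂(Obst.mm (Obst.M1 K Ω') (Obst.M2 K Ω Ω')) := by
    intro u
    unfold SolvesObstacle
    rw [hA]
    refine and_congr_right fun hu => forall₂_congr fun v hv => ?_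
    rw [Obst.Aop_eq hK D hu hv]
  refine ⟨?_, fun u₁ u₂ h1 h2 => ?_⟩
  · rw [hA] at hne
    obtain ⟨u, hu, hmin⟩ := D.exists_min hne
    exact ⟨u, (hiff u).mpr ⟨hu, fun v hv => D.min_solves hu hv hmin⟩⟩
  · have a1 := (hiff u₁).mp h1
    have a2 := (hiff u₂).mp h2
    exact D.unique a1.1 a2.1 a1.2 a2.2
end

section
/- If u ∈ K_{g,h}(Ω,Ω') solves the obstacle problem in K_{g,h}(Ω,Ω'), then u is a weak supersolution of Lu = 0 in Ω, i.e. ∫_{ℝ^n}∫_{ℝ^n} K(x,y) L(u(x),u(y)) (η(x)−η(y)) dx dy ≥ 0 for every nonnegative η ∈ C_0^∞(Ω). -/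
open MeasureTheory Metric Filter
open scoped ENNReal Topology

open Set in
lemma aux_integrable_diff (n : ℕ) (hn : 1 ≤ n) (a : ℝ) (ha : -a < n) (D : Set (Euc n))
    (hDm : MeasurableSet D) (hD : Bornology.IsBounded D) :
    Integrable (fun q : Euc n × Euc n => ‖q.1 - q.2‖ ^ a)
      ((volume.restrict D).prod (volume.restrict D)) := by
  obtain ⟨R, hRpos, hR⟩ := hD.exists_pos_norm_lt
  have h1 : IntegrableOn (fun z : Euc n => ‖z‖ ^ a) (ball 0 (2 * R)) volume := by
    refine integrableOn_ball_of_norm_le_rpow (α := -a) (C := 1) (by simpa using hn)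
      (by simpa using ha) ?_ (Measurable.aestronglyMeasurable (by fun_prop))
    filter_upwards with x
    rw [Real.norm_of_nonneg (by positivity)]; simp
  have h2 : Integrable ((ball (0 : Euc n) (2 * R)).indicator (fun z : Euc n => ‖z‖ ^ a)) volume :=
    h1.integrable_indicator measurableSet_ball
  have h3 : Integrable (D.indicator (fun _ : Euc n => (1 : ℝ))) volume := by
    refine IntegrableOn.integrable_indicator ?_ hDm
    exact integrableOn_const hD.measure_lt_top.ne
  have h4 := Integrable.convolution_integrand (ContinuousLinearMap.mul ℝ ℝ) h3 h2
  have h5 : IntegrableOn (fun q : Euc n × Euc n => ‖q.1 - q.2‖ ^ a) (D ×ˢ D)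
      (volume.prod volume) := by
    refine (h4.integrableOn (s := D ×ˢ D)).congr_fun ?_ (hDm.prod hDm)
    rintro ⟨x, y⟩ ⟨hx, hy⟩
    have : x - y ∈ ball (0 : Euc n) (2 * R) := by
      rw [mem_ball_zero_iff]
      have := norm_sub_le x y
      have := hR x hx
      have := hR y hy
      linarith
    simp only at hx hy
    simp [indicator_of_mem hy, indicator_of_mem this]
  rw [Measure.prod_restrict]
  exact h5

lemma aux_add_rpow (r a b : ℝ) (hr : 0 ≤ r) : |a + b| ^ r ≤ 2 ^ r * (|a| ^ r + |b| ^ r) := by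
  have h1 : |a + b| ≤ 2 * max |a| |b| := by
    have := abs_add_le a b
    have := le_max_left |a| |b|
    have := le_max_right |a| |b|
    linarith
  have h0 : 0 ≤ |a| ^ r := by positivity
  have h0' : 0 ≤ |b| ^ r := by positivity
  calc |a + b| ^ r ≤ (2 * max |a| |b|) ^ r := Real.rpow_le_rpow (abs_nonneg _) h1 hr
    _ = 2 ^ r * (max |a| |b|) ^ r := Real.mul_rpow (by norm_num) (by positivity)
    _ ≤ 2 ^ r * (|a| ^ r + |b| ^ r) := by
      gcongr
      rcases le_total |a| |b| with h | h
      · rw [max_eq_right h]; linarith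
      · rw [max_eq_left h]; linarith

lemma aux_young (p a b : ℝ) (hp : 1 < p) (ha : 0 ≤ a) (hb : 0 ≤ b) :
    a ^ (p - 1) * b ≤ a ^ p + b ^ p := by
  have key : ∀ c : ℝ, 0 ≤ c → c ^ (p - 1) * c = c ^ p := by
    intro c hc
    rcases hc.eq_or_lt with h | h
    · subst h; rw [mul_zero, Real.zero_rpow (by linarith)]
    · rw [Real.rpow_sub_one h.ne']; field_simp
  have h0 : 0 ≤ a ^ p := by positivity
  have h0' : 0 ≤ b ^ p := by positivity
  rcases le_total a b with h | h
  · have : a ^ (p - 1) * b ≤ b ^ (p - 1) * b := by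
      gcongr
    rw [key b hb] at this; linarith
  · have : a ^ (p - 1) * b ≤ a ^ (p - 1) * a := by gcongr
    rw [key a ha] at this; linarith

lemma aux_Lf_abs (p a b : ℝ) (hp : 1 < p) : |Lf p a b| = |a - b| ^ (p - 1) := by
  unfold Lf
  rw [abs_mul, abs_of_nonneg (by positivity : (0 : ℝ) ≤ |a - b| ^ (p - 2))]
  rcases (abs_nonneg (a - b)).eq_or_lt with h | h
  · rw [← h, mul_zero, Real.zero_rpow (by linarith)]
  · have : p - 2 = p - 1 - 1 := by ring
    rw [this, Real.rpow_sub_one h.ne']; field_simp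

lemma aux_Lf_symm (p a b : ℝ) : Lf p b a = - Lf p a b := by
  unfold Lf
  rw [abs_sub_comm]; ring

/-- Test functions are in `W^{s,p}` of bounded sets. -/
lemma aux_memW_test (n : ℕ) (s p : ℝ) (hn : 1 ≤ n) (hs1 : s < 1) (hp : 1 < p)
    (D : Set (Euc n)) (hDo : IsOpen D) (hD : Bornology.IsBounded D)
    (η : Euc n → ℝ) (hη : ContDiff ℝ (⊤ : ℕ∞) η) (hc : HasCompactSupport η) :
    MemW n s p D η := by
  have hcont := hη.continuous
  refine ⟨hcont.measurable.aemeasurable, ?_, ?_⟩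
  · have h1 : Continuous (fun x => |η x| ^ p) :=
      hcont.abs.rpow_const (fun x => Or.inr (by linarith))
    have h2 : HasCompactSupport (fun x => |η x| ^ p) :=
      hc.comp_left (g := fun t : ℝ => |t| ^ p) (by simp; exact Real.zero_rpow (by linarith))
    exact (h1.integrable_of_hasCompactSupport h2).integrableOn
  · obtain ⟨C, hC⟩ := ContDiff.lipschitzWith_of_hasCompactSupport hc hη (by simp)
    have h1 := (aux_integrable_diff n hn (p - ((n : ℝ) + s * p)) (by nlinarith) D
      hDo.measurableSet hD).const_mul ((C : ℝ) ^ p)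
    refine h1.mono' ?_ ?_
    · have := hcont.measurable
      exact Measurable.aestronglyMeasurable (by fun_prop)
    · filter_upwards with q
      rw [Real.norm_of_nonneg (by positivity)]
      have hl : |η q.1 - η q.2| ≤ C * ‖q.1 - q.2‖ := by
        have := hC.dist_le_mul q.1 q.2
        rwa [Real.dist_eq, dist_eq_norm] at this
      rcases (norm_nonneg (q.1 - q.2)).eq_or_lt with h | h
      · rw [← h] at hl
        have h0 : |η q.1 - η q.2| = 0 := le_antisymm (by simpa using hl) (abs_nonneg _)
        rw [h0, Real.zero_rpow (by linarith)]
        simp only [zero_div]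
        positivity
      · rw [Real.rpow_sub h, ← mul_div_assoc, ← Real.mul_rpow (by positivity) h.le]
        gcongr

lemma aux_memW_add (n : ℕ) (s p : ℝ) (hp : 1 < p)
    (D : Set (Euc n)) (v w : Euc n → ℝ) (hv : MemW n s p D v) (hw : MemW n s p D w) :
    MemW n s p D (fun x => v x + w x) := by
  obtain ⟨v1, v2, v3⟩ := hv
  obtain ⟨w1, w2, w3⟩ := hw
  refine ⟨v1.add w1, ?_, ?_⟩
  · refine ((v2.add w2).const_mul (2 ^ p)).mono' ?_ ?_
    · have := v1.add w1
      exact AEMeasurable.aestronglyMeasurable (by fun_prop)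
    · filter_upwards with x
      rw [Real.norm_of_nonneg (by positivity)]
      exact aux_add_rpow p _ _ (by linarith)
  · refine ((v3.add w3).const_mul (2 ^ p)).mono' ?_ ?_
    · have a1 := v1.comp_fst (ν := volume.restrict D)
      have a2 := v1.comp_snd (μ := volume.restrict D)
      have a3 := w1.comp_fst (ν := volume.restrict D)
      have a4 := w1.comp_snd (μ := volume.restrict D)
      exact AEMeasurable.aestronglyMeasurable (by fun_prop)
    · filter_upwards with q
      rw [Real.norm_of_nonneg (by positivity)]
      have e : v q.1 + w q.1 - (v q.2 + w q.2) = (v q.1 - v q.2) + (w q.1 - w q.2) := by ring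
      rw [e, Pi.add_apply, ← add_div, ← mul_div_assoc]
      gcongr
      exact aux_add_rpow p _ _ (by linarith)

lemma aux_kernel_bound (n : ℕ) (s p Λ : ℝ) (hn : 1 ≤ n) (hs0 : 0 < s) (hp : 1 < p)
    (hΛ : 1 ≤ Λ) (K : Euc n → Euc n → ℝ) (hK : IsKernel n s p Λ K) :
    ∀ᵐ z : Euc n × Euc n, 0 < ‖z.1 - z.2‖ ∧ K z.1 z.2 ≤ Λ / ‖z.1 - z.2‖ ^ ((n : ℝ) + s * p) := by
  filter_upwards [hK.2.2.2] with z hz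
  have hpos : 0 < ‖z.1 - z.2‖ := by
    rcases (norm_nonneg (z.1 - z.2)).eq_or_lt with h | h
    · rw [← h, Real.zero_rpow (by positivity)] at hz
      have : 0 < Λ⁻¹ := by positivity
      linarith [hz.1]
    · exact h
  exact ⟨hpos, by rw [le_div_iff₀ (by positivity)]; exact hz.2⟩

lemma aux_weight (n : ℕ) (s p : ℝ) (g : Euc n → ℝ) (hgt : MemTail n s p g)
    (hs0 : 0 < s) (hp : 1 < p) :
    Integrable (fun y : Euc n => |g y| ^ (p - 1) * (1 + ‖y‖) ^ (-((n : ℝ) + s * p))) volume := by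
  obtain ⟨g1, g2, g3⟩ := hgt
  have hm : AEStronglyMeasurable
      (fun y : Euc n => |g y| ^ (p - 1) * (1 + ‖y‖) ^ (-((n : ℝ) + s * p))) volume :=
    AEMeasurable.aestronglyMeasurable (by fun_prop)
  have hσ : 0 < (n : ℝ) + s * p := by positivity
  rw [← integrableOn_univ, ← Set.union_compl_self (ball (0 : Euc n) 1)]
  refine IntegrableOn.union ?_ ?_
  · refine (g2 0 1 one_pos).mono' hm.restrict ?_
    filter_upwards with y
    rw [Real.norm_of_nonneg (by positivity)]
    refine mul_le_of_le_one_right (by positivity) ?_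
    exact Real.rpow_le_one_of_one_le_of_nonpos (by linarith [norm_nonneg y]) (by linarith)
  · refine (g3 0 1 one_pos).mono' hm.restrict ?_
    refine (ae_restrict_iff' measurableSet_ball.compl).2 (ae_of_all _ fun y hy => ?_)
    have hy' : 1 ≤ ‖y‖ := by simpa using hy
    rw [Real.norm_of_nonneg (by positivity), sub_zero]
    gcongr ?_ * ?_
    exact Real.rpow_le_rpow_of_nonpos (by linarith) (by linarith) (by linarith)

lemma aux_cross (n : ℕ) (s p Λ : ℝ) (hn : 1 ≤ n) (hs0 : 0 < s) (hp : 1 < p)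
    (hΛ : 1 ≤ Λ) (K : Euc n → Euc n → ℝ) (hK : IsKernel n s p Λ K)
    (Ω Ω' : Set (Euc n)) (hΩo : IsOpen Ω) (hΩ'o : IsOpen Ω')
    (hΩb : Bornology.IsBounded Ω) (hΩΩ' : closure Ω ⊆ Ω')
    (g : Euc n → ℝ) (hgt : MemTail n s p g)
    (u : Euc n → ℝ) (hu : MemW n s p Ω' u)
    (hug : ∀ᵐ x ∂(volume : Measure (Euc n)), x ∉ Ω → u x = g x)
    (η : Euc n → ℝ) (hηc : Continuous η) (hc : HasCompactSupport η)
    (hsupp : ∀ x, x ∉ Ω → η x = 0)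
    (hm : AEStronglyMeasurable (fun q : Euc n × Euc n =>
      K q.1 q.2 * Lf p (u q.1) (u q.2) * (η q.1 - η q.2)) (volume.prod volume)) :
    IntegrableOn (fun q : Euc n × Euc n =>
      K q.1 q.2 * Lf p (u q.1) (u q.2) * (η q.1 - η q.2)) (Ω ×ˢ Ω'ᶜ) (volume.prod volume) := by
  have hσ : 0 < (n : ℝ) + s * p := by positivity
  have hΩsub : Ω ⊆ Ω' := subset_closure.trans hΩΩ'
  obtain ⟨M, hM⟩ := hηc.bounded_above_of_compact_support hc
  have hM0 : 0 ≤ M := (norm_nonneg _).trans (hM 0)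
  obtain ⟨R, hRpos, hR⟩ := hΩb.exists_pos_norm_lt
  obtain ⟨δ, hδ, hthick⟩ :=
    hΩb.isCompact_closure.exists_thickening_subset_open hΩ'o hΩΩ'
  set c : ℝ := (1 + R) / δ + 1 with hcdef
  have hcpos : 0 < c := by positivity
  -- integrability of the factors
  have hup : IntegrableOn (fun x => |u x| ^ (p - 1)) Ω volume := by
    have h1 : IntegrableOn (fun x => |u x| ^ p) Ω volume := hu.2.1.mono_set hΩsub
    have h2 : IntegrableOn (fun _ : Euc n => (1 : ℝ)) Ω volume :=
      integrableOn_const hΩb.measure_lt_top.ne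
    have hum : AEMeasurable u (volume.restrict Ω) :=
      hu.1.mono_measure (Measure.restrict_mono hΩsub le_rfl)
    refine (h1.add h2).mono' (AEMeasurable.aestronglyMeasurable (by fun_prop)) ?_
    filter_upwards with x
    rw [Real.norm_of_nonneg (by positivity)]
    simpa using aux_young p |u x| 1 hp (abs_nonneg _) zero_le_one
  have h1 : IntegrableOn (fun _ : Euc n => (1 : ℝ)) Ω volume :=
    integrableOn_const hΩb.measure_lt_top.ne
  have hw : Integrable (fun y : Euc n => (1 + ‖y‖) ^ (-((n : ℝ) + s * p))) volume := by
    refine integrable_one_add_norm ?_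
    rw [finrank_euclideanSpace, Fintype.card_fin]
    have : 0 < s * p := by positivity
    linarith
  have hgw := aux_weight n s p g hgt hs0 hp
  have hd1 := Integrable.mul_prod hup (hw.integrableOn (s := Ω'ᶜ))
  have hd2 := Integrable.mul_prod h1 (hgw.integrableOn (s := Ω'ᶜ))
  have hd := (hd1.add hd2).const_mul (Λ * c ^ ((n : ℝ) + s * p) * 2 ^ (p - 1) * M)
  rw [Measure.prod_restrict] at hd
  refine hd.mono' hm.restrict ?_
  rw [ae_restrict_iff' (hΩo.measurableSet.prod hΩ'o.measurableSet.compl)]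
  have hug2 := (Measure.quasiMeasurePreserving_snd (μ := (volume : Measure (Euc n)))
    (ν := (volume : Measure (Euc n)))).ae hug
  filter_upwards [hug2, aux_kernel_bound n s p Λ hn hs0 hp hΛ K hK] with q hq hKq hmem
  obtain ⟨hx, hy⟩ := hmem
  have hyΩ : q.2 ∉ Ω := fun h => hy (hΩsub h)
  rw [hq hyΩ, hsupp _ hyΩ, sub_zero, norm_mul, norm_mul, Real.norm_of_nonneg (hK.2.2.1 _ _),
    Real.norm_eq_abs (Lf _ _ _), aux_Lf_abs p _ _ hp]
  have hdist : δ ≤ ‖q.1 - q.2‖ := by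
    by_contra hlt
    push Not at hlt
    refine hy (hthick ?_)
    rw [mem_thickening_iff]
    exact ⟨q.1, subset_closure hx, by rwa [dist_comm, dist_eq_norm]⟩
  have hxR := hR _ hx
  have hyn : 1 + ‖q.2‖ ≤ c * ‖q.1 - q.2‖ := by
    have e1 : ‖q.2‖ ≤ ‖q.1‖ + ‖q.1 - q.2‖ := by
      have := norm_sub_le q.1 (q.1 - q.2)
      simpa using this
    have e2 : 1 + R ≤ (1 + R) / δ * ‖q.1 - q.2‖ := by
      rw [div_mul_eq_mul_div, le_div_iff₀ hδ]
      gcongr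
    rw [hcdef, add_mul, one_mul]
    linarith
  have hw' : K q.1 q.2 ≤ Λ * c ^ ((n : ℝ) + s * p) * (1 + ‖q.2‖) ^ (-((n : ℝ) + s * p)) := by
    refine hKq.2.trans ?_
    have hy0 : 0 < 1 + ‖q.2‖ := by positivity
    rw [Real.rpow_neg hy0.le, ← div_eq_mul_inv, div_le_div_iff₀ (Real.rpow_pos_of_pos hKq.1 _)
      (by positivity), mul_assoc, ← Real.mul_rpow hcpos.le hKq.1.le]
    gcongr
  have hL : |u q.1 - g q.2| ^ (p - 1) ≤ 2 ^ (p - 1) * (|u q.1| ^ (p - 1) + |g q.2| ^ (p - 1)) := by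
    have := aux_add_rpow (p - 1) (u q.1) (- g q.2) (by linarith)
    rwa [abs_neg, ← sub_eq_add_neg] at this
  calc K q.1 q.2 * |u q.1 - g q.2| ^ (p - 1) * ‖η q.1‖
      ≤ (Λ * c ^ ((n : ℝ) + s * p) * (1 + ‖q.2‖) ^ (-((n : ℝ) + s * p))) *
        (2 ^ (p - 1) * (|u q.1| ^ (p - 1) + |g q.2| ^ (p - 1))) * M := by
        gcongr
        exact hM _
    _ = _ := by
      simp only [Pi.add_apply]
      ring

/-- Theorem 3.2 (cont.): the solution to the obstacle problem is a weak supersolution of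
`Lu = 0` in `Ω`. -/
theorem obstacle_solution_is_supersolution
    (n : ℕ) (s p Λ : ℝ) (hn : 1 ≤ n) (hs0 : 0 < s) (hs1 : s < 1) (hp : 1 < p)
    (hΛ : 1 ≤ Λ) (K : Euc n → Euc n → ℝ) (hK : IsKernel n s p Λ K)
    (Ω Ω' : Set (Euc n)) (hΩo : IsOpen Ω) (hΩ'o : IsOpen Ω')
    (hΩb : Bornology.IsBounded Ω) (hΩ'b : Bornology.IsBounded Ω') (hΩΩ' : closure Ω ⊆ Ω')
    (g : Euc n → ℝ) (h : Euc n → EReal)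
    (hg : MemW n s p Ω' g) (hgt : MemTail n s p g)
    (hne : (obstacleSet n s p Ω Ω' g h).Nonempty)
    (u : Euc n → ℝ) (hu : SolvesObstacle n s p Ω Ω' g h K u) :
    ∀ η : Euc n → ℝ, ContDiff ℝ (⊤ : ℕ∞) η → HasCompactSupport η → tsupport η ⊆ Ω →
      (∀ x, 0 ≤ η x) →
      0 ≤ ∫ x, ∫ y, K x y * Lf p (u x) (u y) * (η x - η y) := by
  intro η hη hc hts hη0
  obtain ⟨huK, hsol⟩ := hu
  obtain ⟨huW, huh, hug⟩ := huK
  have hΩsub : Ω ⊆ Ω' := subset_closure.trans hΩΩ'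
  have hηc : Continuous η := hη.continuous
  have hsupp : ∀ x, x ∉ Ω → η x = 0 := fun x hx =>
    image_eq_zero_of_notMem_tsupport (fun h => hx (hts h))
  have hηW := aux_memW_test n s p hn hs1 hp Ω' hΩ'o hΩ'b η hη hc
  have hA : 0 ≤ Aop n p Ω Ω' g K u η := by
    have := hsol (fun x => u x + η x) ⟨aux_memW_add n s p hp Ω' u η huW hηW, ?_, ?_⟩
    · simpa using this
    · filter_upwards [huh] with x hx hxΩ
      refine (hx hxΩ).trans ?_
      exact_mod_cast le_add_of_nonneg_right (hη0 x)
    · filter_upwards [hug] with x hx hxΩ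
      rw [hsupp x hxΩ, add_zero, hx hxΩ]
  -- measurability
  have hum : AEMeasurable u volume := by
    rw [← Measure.restrict_univ (μ := volume), ← Set.union_compl_self Ω', aemeasurable_union_iff]
    refine ⟨huW.1, hgt.1.restrict.congr ?_⟩
    rw [Filter.EventuallyEq, ae_restrict_iff' hΩ'o.measurableSet.compl]
    filter_upwards [hug] with x hx hxΩ
    exact (hx fun h => hxΩ (hΩsub h)).symm
  set G : Euc n × Euc n → ℝ := fun q =>
    K q.1 q.2 * Lf p (u q.1) (u q.2) * (η q.1 - η q.2) with hG
  have hm : AEStronglyMeasurable G (volume.prod volume) := by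
    have a1 := hum.comp_fst (ν := (volume : Measure (Euc n)))
    have a2 := hum.comp_snd (μ := (volume : Measure (Euc n)))
    have a3 : Measurable (fun q : Euc n × Euc n => K q.1 q.2) := hK.1
    have a4 := hηc.measurable
    refine AEMeasurable.aestronglyMeasurable ?_
    simp only [hG, Lf]
    fun_prop
  have hI2 : IntegrableOn G (Ω ×ˢ Ω'ᶜ) (volume.prod volume) :=
    aux_cross n s p Λ hn hs0 hp hΛ K hK Ω Ω' hΩo hΩ'o hΩb hΩΩ' g hgt u huW hug η hηc hc hsupp hm
  have hsymm : ∀ q : Euc n × Euc n, G q.swap = G q := by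
    rintro ⟨x, y⟩
    simp only [hG, Prod.swap]
    rw [hK.2.1 y x, aux_Lf_symm p (u x) (u y)]
    ring
  have hI3 : IntegrableOn G (Ω'ᶜ ×ˢ Ω) (volume.prod volume) := by
    have h1 := hI2
    rw [IntegrableOn, ← Measure.prod_restrict] at h1 ⊢
    have h2 := h1.swap
    refine h2.congr (ae_of_all _ fun q => ?_)
    exact hsymm q
  have hI1 : IntegrableOn G (Ω' ×ˢ Ω') (volume.prod volume) := by
    have hd := (huW.2.2.add hηW.2.2).const_mul Λ
    rw [Measure.prod_restrict] at hd
    refine hd.mono' hm.restrict (ae_restrict_of_ae ?_)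
    filter_upwards [aux_kernel_bound n s p Λ hn hs0 hp hΛ K hK] with q hKq
    simp only [hG]
    rw [norm_mul, norm_mul, Real.norm_of_nonneg (hK.2.2.1 _ _),
      Real.norm_eq_abs (Lf _ _ _), aux_Lf_abs p _ _ hp, Real.norm_eq_abs, mul_assoc]
    calc K q.1 q.2 * (|u q.1 - u q.2| ^ (p - 1) * |η q.1 - η q.2|)
        ≤ (Λ / ‖q.1 - q.2‖ ^ ((n : ℝ) + s * p)) *
          (|u q.1 - u q.2| ^ p + |η q.1 - η q.2| ^ p) := by
          gcongr
          · exact hKq.2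
          · exact aux_young p _ _ hp (abs_nonneg _) (abs_nonneg _)
      _ = _ := by
        simp only [Pi.add_apply]
        ring
  -- assemble
  have hzero : ∀ q ∉ (Ω' ×ˢ Ω' ∪ Ω ×ˢ Ω'ᶜ) ∪ Ω'ᶜ ×ˢ Ω, G q = 0 := by
    rintro ⟨x, y⟩ hq
    simp only [Set.mem_union, Set.mem_prod, Set.mem_compl_iff, not_or] at hq
    have hx : x ∉ Ω := by
      intro h
      by_cases hy : y ∈ Ω'
      · exact hq.1.1 ⟨hΩsub h, hy⟩
      · exact hq.1.2 ⟨h, hy⟩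
    have hy : y ∉ Ω := by
      intro h
      by_cases hx : x ∈ Ω'
      · exact hq.1.1 ⟨hx, hΩsub h⟩
      · exact hq.2 ⟨hx, h⟩
    simp [hG, hsupp x hx, hsupp y hy]
  have hI12 := hI1.union hI2
  have hI123 := hI12.union hI3
  have hGint : Integrable G (volume.prod volume) := by
    refine (integrableOn_iff_integrable_of_support_subset ?_).1 hI123
    intro q hq
    by_contra hcon
    exact hq (hzero q hcon)
  have e0 : (∫ x, ∫ y, K x y * Lf p (u x) (u y) * (η x - η y)) =
      ∫ q, G q ∂(volume.prod volume) := (integral_prod G hGint).symm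
  have hms1 := hΩ'o.measurableSet
  have hms2 := hΩo.measurableSet
  have d1 : Disjoint (Ω' ×ˢ Ω' ∪ Ω ×ˢ Ω'ᶜ) (Ω'ᶜ ×ˢ Ω) := by
    rw [Set.disjoint_left]
    rintro ⟨x, y⟩ h1 ⟨h2, h3⟩
    rcases h1 with h1 | h1
    · exact h2 h1.1
    · exact h2 (hΩsub h1.1)
  have d2 : Disjoint (Ω' ×ˢ Ω') (Ω ×ˢ Ω'ᶜ) := by
    rw [Set.disjoint_left]
    rintro ⟨x, y⟩ h1 h2
    exact h2.2 h1.2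
  have e1 : (∫ q in Ω'ᶜ ×ˢ Ω, G q ∂(volume.prod volume)) =
      ∫ q in Ω ×ˢ Ω'ᶜ, G q ∂(volume.prod volume) := by
    rw [← setIntegral_prod_swap]
    simp only [hsymm]
  have e2 : (∫ q in Ω ×ˢ Ω'ᶜ, G q ∂(volume.prod volume)) =
      ∫ y in Ω'ᶜ, ∫ x in Ω, Lf p (u x) (g y) * η x * K x y := by
    have h1 := hI2
    rw [IntegrableOn, ← Measure.prod_restrict] at h1
    rw [← Measure.prod_restrict, integral_prod_symm _ h1]
    refine integral_congr_ae ?_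
    rw [Filter.EventuallyEq, ae_restrict_iff' hms1.compl]
    filter_upwards [hug] with y hy hyΩ'
    have hyΩ : y ∉ Ω := fun h => hyΩ' (hΩsub h)
    refine integral_congr_ae (ae_of_all _ fun x => ?_)
    simp only [hG, hy hyΩ, hsupp y hyΩ]
    ring
  have e3 : (∫ q in Ω' ×ˢ Ω', G q ∂(volume.prod volume)) =
      ∫ x in Ω', ∫ y in Ω', Lf p (u x) (u y) * (η x - η y) * K x y := by
    rw [setIntegral_prod _ hI1]
    refine integral_congr_ae (ae_of_all _ fun x => integral_congr_ae (ae_of_all _ fun y => ?_))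
    simp only [hG]
    ring
  rw [e0, ← setIntegral_eq_integral_of_forall_compl_eq_zero hzero,
    setIntegral_union d1 (hms1.compl.prod hms2) hI12 hI3,
    setIntegral_union d2 (hms2.prod hms1.compl) hI1 hI2, e1, e2, e3]
  unfold Aop at hA
  linarith
end
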